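/- arXiv:1812.09388 — 2 statements merged into one kernel-verified Lean document; each statement's English description precedes it below -/
import Mathlib

section
/- (Lemma 2.7, velocity lemma near the boundary) Suppose E satisfies ‖E‖_∞ + ‖∇_x E‖_∞ + ‖∂_t E‖_∞ < ∞ and the sign condition E(t,x)·n(x) > C_E > 0 for all t and all x ∈ ∂Ω. Then α is continuous, and for δ ≪ 1 small enough, for any 0 ≤ s < t and any characteristic trajectory (X(τ),V(τ)) with X(τ) ∈ Ω for all s ≤ τ ≤ t, the distance function α satisfies e^{−C ∫ₛᵗ (|V(τ')|+1) dτ'} α(s,X(s),V(s)) ≤ α(t,X(t),V(t)) ≤ e^{C ∫ₛᵗ (|V(τ')|+1) dτ'} α(s,X(s),V(s)), for any C ≥ C_ξ (‖E‖_∞ + ‖∇E‖_∞ + ‖∂_t E‖_∞ + 1)/C_E, where C_ξ > 0 is a large constant depending only on ξ. -/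
open MeasureTheory Real
open scoped RealInnerProductSpace ENNReal

noncomputable section

abbrev E3 := EuclideanSpace ℝ (Fin 3)

/-- The outward unit normal `n(x) = ∇ξ(x)/|∇ξ(x)|`. -/
def nvec (ξ : E3 → ℝ) (x : E3) : E3 := ‖gradient ξ x‖⁻¹ • gradient ξ x

/-- The auxiliary function
`β(t,x,v) = [ (v·∇ξ(x))² + ξ(x)² − 2(v·∇²ξ(x)·v)ξ(x) − 2(E(t,x̄)·∇ξ(x̄))ξ(x) ]^{1/2}`,
where `x̄ = near x` is the nearest boundary point. -/
def betaW (ξ : E3 → ℝ) (Efld : ℝ → E3 → E3) (near : E3 → E3) (t : ℝ) (x v : E3) : ℝ :=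
  Real.sqrt (⟪v, gradient ξ x⟫ ^ 2 + ξ x ^ 2
    - 2 * (iteratedFDeriv ℝ 2 ξ x ![v, v]) * ξ x
    - 2 * ⟪Efld t (near x), gradient ξ (near x)⟫ * ξ x)

/-- The distance function to the grazing set: `α = χ_{δ'}(β)` on the boundary layer
`Ω^δ = {d(x,∂Ω) < δ}` and `α ≡ C_{δ'}` away from the boundary. -/
def alphaW (ξ : E3 → ℝ) (Ω : Set E3) (Efld : ℝ → E3 → E3) (near : E3 → E3)
    (χ : ℝ → ℝ) (δw Cδ : ℝ) (t : ℝ) (x v : E3) : ℝ :=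
  if Metric.infDist x (frontier Ω) < δw then χ (betaW ξ Efld near t x v) else Cδ

lemma vl_chi_mono {δ' Cδ : ℝ} {χ : ℝ → ℝ} (hδ' : 0 < δ')
    (h1 : ∀ s : ℝ, 0 ≤ s → s ≤ δ' / 4 → χ s = s)
    (h2 : ∀ s : ℝ, δ' / 2 ≤ s → χ s = Cδ)
    (h3 : MonotoneOn χ (Set.Icc (δ' / 4) (δ' / 2))) {a b : ℝ} (ha : 0 ≤ a) (hab : a ≤ b) :
    χ a ≤ χ b := by
  have key : ∀ c, δ' / 4 ≤ c → c ≤ δ' / 2 → χ c ≤ Cδ := by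
    intro c hc hc'
    rw [← h2 (δ' / 2) le_rfl]
    exact h3 ⟨hc, hc'⟩ ⟨by linarith, le_rfl⟩ hc'
  have key2 : ∀ c, δ' / 4 ≤ c → δ' / 4 ≤ χ c := by
    intro c hc
    have e := h1 (δ' / 4) (by linarith) le_rfl
    rcases le_total c (δ' / 2) with h | h
    · have := h3 ⟨le_rfl, by linarith⟩ ⟨hc, h⟩ hc
      linarith
    · rw [h2 c h]
      have := key (δ' / 4) le_rfl (by linarith)
      linarith
  rcases le_total b (δ' / 4) with hb | hb
  · rw [h1 a ha (hab.trans hb), h1 b (ha.trans hab) hb]; exact hab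
  rcases le_total a (δ' / 4) with ha' | ha'
  · rw [h1 a ha ha']; exact ha'.trans (key2 b hb)
  rcases le_total b (δ' / 2) with hb' | hb'
  · exact h3 ⟨ha', hab.trans hb'⟩ ⟨hb, hb'⟩ hab
  · rw [h2 b hb']
    rcases le_total a (δ' / 2) with h | h
    · exact key a ha' h
    · rw [h2 a h]

lemma vl_chi_pos {δ' Cδ : ℝ} {χ : ℝ → ℝ} (hδ' : 0 < δ')
    (h1 : ∀ s : ℝ, 0 ≤ s → s ≤ δ' / 4 → χ s = s)
    (h2 : ∀ s : ℝ, δ' / 2 ≤ s → χ s = Cδ)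
    (h3 : MonotoneOn χ (Set.Icc (δ' / 4) (δ' / 2))) {a : ℝ} (ha : 0 < a) : 0 < χ a := by
  rcases le_total a (δ' / 4) with h | h
  · rw [h1 a ha.le h]; exact ha
  · have := vl_chi_mono hδ' h1 h2 h3 (by linarith) h
    rw [h1 _ (by linarith) le_rfl] at this
    linarith

lemma vl_chi_sq {δ' Cδ : ℝ} {χ : ℝ → ℝ} (hδ' : 0 < δ') (hχ : Differentiable ℝ χ)
    (h1 : ∀ s : ℝ, 0 ≤ s → s ≤ δ' / 4 → χ s = s)
    (h2 : ∀ s : ℝ, δ' / 2 ≤ s → χ s = Cδ)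
    (h3 : MonotoneOn χ (Set.Icc (δ' / 4) (δ' / 2)))
    (h4 : ∀ s : ℝ, deriv χ s ≤ 1) {a b : ℝ} (ha : 0 < a) (hab : a ≤ b) :
    χ b * a ^ 2 ≤ χ a * b ^ 2 := by
  have main : ∀ a b, 0 < a → a ≤ b → b ≤ δ' / 2 → χ b * a ^ 2 ≤ χ a * b ^ 2 := by
    intro a b ha hab hb
    have hl : χ b - χ a ≤ b - a := by
      have := image_sub_le_mul_sub_of_deriv_le hχ h4 hab
      linarith
    have hh : a / 2 ≤ χ a := by
      rcases le_total a (δ' / 4) with h | h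
      · rw [h1 a ha.le h]; linarith
      · have := vl_chi_mono hδ' h1 h2 h3 (by linarith) h
        rw [h1 _ (by linarith) le_rfl] at this
        linarith
    have e1 : χ b * a ^ 2 ≤ (χ a + (b - a)) * a ^ 2 :=
      mul_le_mul_of_nonneg_right (by linarith) (by positivity)
    have e2 : a / 2 * ((b - a) * (b + a)) ≤ χ a * ((b - a) * (b + a)) :=
      mul_le_mul_of_nonneg_right hh (mul_nonneg (by linarith) (by linarith))
    have e3 : (b - a) * a ^ 2 ≤ a / 2 * ((b - a) * (b + a)) := by
      have : 0 ≤ a * ((b - a) * (b - a)) := by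
        have : 0 ≤ b - a := by linarith
        positivity
      nlinarith
    nlinarith
  rcases le_total b (δ' / 2) with hb | hb
  · exact main a b ha hab hb
  rcases le_total a (δ' / 2) with ha' | ha'
  · have := main a (δ' / 2) ha ha' le_rfl
    rw [h2 b hb, ← h2 (δ' / 2) le_rfl]
    refine this.trans ?_
    have hp := (vl_chi_pos hδ' h1 h2 h3 ha).le
    gcongr
  · rw [h2 b hb, h2 a ha']
    have hp := (vl_chi_pos hδ' h1 h2 h3 ha).le
    rw [h2 a ha'] at hp
    gcongr

lemma vl_log_sub {p q : ℝ} (hp : 0 < p) (hq : 0 < q) :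
    log q - log p ≤ |q - p| / min p q := by
  have hm : 0 < min p q := lt_min hp hq
  rw [← log_div hq.ne' hp.ne']
  have h1 := log_le_sub_one_of_pos (div_pos hq hp)
  refine h1.trans ?_
  have : q / p - 1 = (q - p) / p := by field_simp
  rw [this]
  calc (q - p) / p ≤ |q - p| / p := by gcongr; exact le_abs_self _
    _ ≤ |q - p| / min p q := by gcongr; exact min_le_left _ _

/-- Comparison of `log χ(√·)` with the increment of the argument. -/
lemma vl_chi_log {δ' Cδ : ℝ} {χ : ℝ → ℝ} (hδ' : 0 < δ') (hχ : Differentiable ℝ χ)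
    (h1 : ∀ s : ℝ, 0 ≤ s → s ≤ δ' / 4 → χ s = s)
    (h2 : ∀ s : ℝ, δ' / 2 ≤ s → χ s = Cδ)
    (h3 : MonotoneOn χ (Set.Icc (δ' / 4) (δ' / 2)))
    (h4 : ∀ s : ℝ, deriv χ s ≤ 1) {p q : ℝ} (hp : 0 < p) (hq : 0 < q) :
    |log (χ (√q)) - log (χ (√p))| ≤ |q - p| / min p q := by
  have main : ∀ p q : ℝ, 0 < p → p ≤ q →
      |log (χ (√q)) - log (χ (√p))| ≤ |q - p| / min p q := by
    intro p q hp hpq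
    have hq : 0 < q := hp.trans_le hpq
    have cp := vl_chi_pos hδ' h1 h2 h3 (sqrt_pos.2 hp)
    have cq := vl_chi_pos hδ' h1 h2 h3 (sqrt_pos.2 hq)
    have hs := sqrt_le_sqrt hpq
    have m := log_le_log cp (vl_chi_mono hδ' h1 h2 h3 (sqrt_nonneg p) hs)
    rw [abs_of_nonneg (by linarith)]
    have k := vl_chi_sq hδ' hχ h1 h2 h3 h4 (sqrt_pos.2 hp) hs
    rw [sq_sqrt hp.le, sq_sqrt hq.le] at k
    have k2 := log_le_log (by positivity) k
    rw [log_mul cq.ne' hp.ne', log_mul cp.ne' hq.ne'] at k2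
    have := vl_log_sub hp hq
    linarith
  rcases le_total p q with h | h
  · exact main p q hp h
  · rw [abs_sub_comm, abs_sub_comm q p, min_comm]
    exact main q p hq h

set_option maxSynthPendingDepth 4 in
/-- Constants depending only on `ξ`. -/
lemma vl_consts (ξ : E3 → ℝ) (hξ : ContDiff ℝ 3 ξ)
    (Ω : Set E3) (hbd : Bornology.IsBounded Ω)
    (hfr : frontier Ω = {x | ξ x = 0})
    (hgrad : ∃ ε > 0, ∀ x : E3, |ξ x| < ε → gradient ξ x ≠ 0) :
    ∃ K : Set E3, ∃ G M T g₀ : ℝ, Convex ℝ K ∧ closure Ω ⊆ K ∧ 0 < G ∧ 0 < M ∧ 0 < T ∧ 0 < g₀ ∧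
      (∀ x ∈ K, ‖fderiv ℝ ξ x‖ ≤ G) ∧
      (∀ x ∈ K, ‖fderiv ℝ (fderiv ℝ ξ) x‖ ≤ M) ∧
      (∀ x ∈ K, ∀ v, |fderiv ℝ (fderiv ℝ (fderiv ℝ ξ)) x v v v| ≤ T * ‖v‖ ^ 3) ∧
      (∀ p ∈ frontier Ω, g₀ ≤ ‖fderiv ℝ ξ p‖) := by
  obtain ⟨R, hR⟩ := hbd.closure.subset_closedBall (0 : E3)
  have c1 : ContDiff ℝ 2 (fderiv ℝ ξ) := hξ.fderiv_right (by norm_num)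
  have c2 : ContDiff ℝ 1 (fderiv ℝ (fderiv ℝ ξ)) := c1.fderiv_right (by norm_num)
  have c3 : Continuous (fderiv ℝ (fderiv ℝ (fderiv ℝ ξ))) := c2.continuous_fderiv (by norm_num)
  have hK := isCompact_closedBall (0 : E3) R
  obtain ⟨G, hG⟩ := hK.exists_bound_of_continuousOn c1.continuous.continuousOn
  obtain ⟨M, hM⟩ := hK.exists_bound_of_continuousOn c2.continuous.continuousOn
  obtain ⟨T, hT⟩ := hK.exists_bound_of_continuousOn c3.continuousOn
  have hg : ∃ g₀ > 0, ∀ p ∈ frontier Ω, g₀ ≤ ‖fderiv ℝ ξ p‖ := by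
    have hFc : IsCompact (frontier Ω) :=
      hbd.isCompact_closure.of_isClosed_subset isClosed_frontier frontier_subset_closure
    rcases (frontier Ω).eq_empty_or_nonempty with h | h
    · exact ⟨1, one_pos, by simp [h]⟩
    obtain ⟨p, hp, hmin⟩ := hFc.exists_isMinOn h c1.continuous.norm.continuousOn
    refine ⟨‖fderiv ℝ ξ p‖, ?_, fun q hq => hmin hq⟩
    obtain ⟨ε, hε, hh⟩ := hgrad
    have hp0 : ξ p = 0 := by rw [hfr] at hp; exact hp
    have := hh p (by rw [hp0]; simpa using hε)
    refine norm_pos_iff.2 ?_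
    intro h0
    apply this
    simp [gradient, h0]
  obtain ⟨g₀, hg0, hg⟩ := hg
  refine ⟨Metric.closedBall 0 R, |G| + 1, |M| + 1, |T| + 1, g₀, convex_closedBall _ _, hR,
    by positivity, by positivity, by positivity, hg0,
    fun x hx => (hG x hx).trans (by linarith [le_abs_self G]),
    fun x hx => (hM x hx).trans (by linarith [le_abs_self M]),
    fun x hx v => ?_, hg⟩
  set L := fderiv ℝ (fderiv ℝ (fderiv ℝ ξ)) x with hL
  rw [← Real.norm_eq_abs]
  calc ‖L v v v‖ ≤ ‖L v v‖ * ‖v‖ := (L v v).le_opNorm v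
    _ ≤ (‖L v‖ * ‖v‖) * ‖v‖ := by gcongr; exact (L v).le_opNorm v
    _ ≤ ((‖L‖ * ‖v‖) * ‖v‖) * ‖v‖ := by gcongr; exact L.le_opNorm v
    _ = ‖L‖ * ‖v‖ ^ 3 := by ring
    _ ≤ (|T| + 1) * ‖v‖ ^ 3 := by
      gcongr
      exact (hT x hx).trans (by linarith [le_abs_self T])

/-- second-order Taylor estimate -/
lemma vl_taylor (ξ : E3 → ℝ) (hξ : ContDiff ℝ 3 ξ) {K : Set E3} (hK : Convex ℝ K) {M : ℝ}
    (hM : ∀ x ∈ K, ‖fderiv ℝ (fderiv ℝ ξ) x‖ ≤ M) (hM0 : 0 < M) {p y : E3} (hp : p ∈ K) (hy : y ∈ K) :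
    |ξ y - ξ p - fderiv ℝ ξ p (y - p)| ≤ M * ‖y - p‖ ^ 2 := by
  have c1 : ContDiff ℝ 2 (fderiv ℝ ξ) := hξ.fderiv_right (by norm_num)
  have d0 : Differentiable ℝ ξ := hξ.differentiable (by norm_num)
  have d1 : Differentiable ℝ (fderiv ℝ ξ) := c1.differentiable (by norm_num)
  have := (hK.inter (convex_closedBall p ‖y - p‖)).norm_image_sub_le_of_norm_fderiv_le'
    (f := ξ) (φ := fderiv ℝ ξ p) (C := M * ‖y - p‖) (𝕜 := ℝ) (fun x _ => d0 x) (fun x hx => ?_)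
    (x := p) (y := y) ⟨hp, by simp⟩ ⟨hy, by simp [dist_eq_norm]⟩
  · rw [← Real.norm_eq_abs]
    calc _ ≤ _ := this
      _ = _ := by ring
  · refine (hK.norm_image_sub_le_of_norm_fderiv_le (fun x _ => d1 x) hM hp hx.1).trans ?_
    have := hx.2
    rw [Metric.mem_closedBall, dist_eq_norm] at this
    gcongr

lemma vl_lagrange (ξ : E3 → ℝ) (hξ : ContDiff ℝ 3 ξ) {p x : E3}
    (hp : ξ p = 0) (hmin : ∀ q, ξ q = 0 → dist x p ≤ dist x q) (hg : fderiv ℝ ξ p ≠ 0) :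
    ∃ c : ℝ, ∀ w, ⟪x - p, w⟫ = c * fderiv ℝ ξ p w := by
  have hs : HasStrictFDerivAt ξ (fderiv ℝ ξ p) p :=
    (hξ.contDiffAt).hasStrictFDerivAt (by norm_num)
  have hφ : HasStrictFDerivAt (fun y : E3 => ‖y - x‖ ^ 2) (2 • (innerSL ℝ (p - x))) p := by
    have := (hasStrictFDerivAt_norm_sq (p - x)).comp p ((hasStrictFDerivAt_id p).sub_const x)
    simpa [Function.comp_def] using this
  have hext : IsLocalExtrOn (fun y : E3 => ‖y - x‖ ^ 2) {y | ξ y = ξ p} p := by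
    left
    refine eventually_nhdsWithin_of_forall (fun y hy => ?_)
    have := hmin y (hy.trans hp)
    rw [dist_eq_norm', dist_eq_norm'] at this
    show ‖p - x‖ ^ 2 ≤ ‖y - x‖ ^ 2
    gcongr
  obtain ⟨a, b, hab, h⟩ := hext.exists_multipliers_of_hasStrictFDerivAt_1d hs hφ
  have hb : b ≠ 0 := by
    rintro rfl
    have ha : a ≠ 0 := fun h' => hab (by simp [h'])
    simp [ha] at h
    exact hg h
  refine ⟨a / (2 * b), fun w => ?_⟩
  have hw := congrArg (fun L => L w) h
  simp at hw
  rw [inner_sub_left]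
  field_simp
  linarith

lemma vl_near (ξ : E3 → ℝ) (hξ : ContDiff ℝ 3 ξ) {p x : E3} {g₀ : ℝ} (hg0 : 0 < g₀)
    (hp : ξ p = 0) (hmin : ∀ q, ξ q = 0 → dist x p ≤ dist x q) (hg : g₀ ≤ ‖fderiv ℝ ξ p‖) :
    g₀ * ‖x - p‖ ≤ |fderiv ℝ ξ p (x - p)| ∧
    ∀ w, g₀ * |⟪x - p, w⟫| ≤ ‖x - p‖ * |fderiv ℝ ξ p w| := by
  have hne : fderiv ℝ ξ p ≠ 0 := by
    intro h; rw [h, norm_zero] at hg; linarith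
  obtain ⟨c, hc⟩ := vl_lagrange ξ hξ hp hmin hne
  have hcn : |c| * ‖fderiv ℝ ξ p‖ ≤ ‖x - p‖ := by
    rw [← Real.norm_eq_abs, ← norm_smul]
    refine ContinuousLinearMap.opNorm_le_bound _ (norm_nonneg _) (fun w => ?_)
    have : (c • fderiv ℝ ξ p) w = ⟪x - p, w⟫ := by rw [hc w]; simp
    rw [this]
    exact norm_inner_le_norm _ _
  have hcg : g₀ * |c| ≤ ‖x - p‖ := by nlinarith [abs_nonneg c]
  have second : ∀ w, g₀ * |⟪x - p, w⟫| ≤ ‖x - p‖ * |fderiv ℝ ξ p w| := by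
    intro w
    rw [hc w, abs_mul, ← mul_assoc]
    gcongr
  refine ⟨?_, second⟩
  have := second (x - p)
  rw [real_inner_self_eq_norm_sq, abs_of_nonneg (by positivity)] at this
  rcases (norm_nonneg (x - p)).eq_or_lt with h | h
  · rw [← h]; simp
  · have h2 : ‖x - p‖ * (g₀ * ‖x - p‖) ≤ ‖x - p‖ * |fderiv ℝ ξ p (x - p)| := by nlinarith
    exact le_of_mul_le_mul_left h2 h

/-- Lipschitz nearest-point projection. -/
lemma vl_near_lip (ξ : E3 → ℝ) (hξ : ContDiff ℝ 3 ξ) {K : Set E3} (hK : Convex ℝ K) {M g₀ δ : ℝ}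
    (hM : ∀ x ∈ K, ‖fderiv ℝ (fderiv ℝ ξ) x‖ ≤ M) (hM0 : 0 < M) (hg0 : 0 < g₀)
    (hδ : 4 * M * δ ≤ g₀)
    (hg : ∀ p, ξ p = 0 → g₀ ≤ ‖fderiv ℝ ξ p‖) (h0K : ∀ p, ξ p = 0 → p ∈ K)
    {x y p q : E3} (hp : ξ p = 0) (hq : ξ q = 0)
    (hpm : ∀ q, ξ q = 0 → dist x p ≤ dist x q) (hqm : ∀ p, ξ p = 0 → dist y q ≤ dist y p)
    (hx : dist x p ≤ δ) (hy : dist y q ≤ δ) :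
    ‖p - q‖ ≤ 2 * ‖x - y‖ := by
  have a1 := (vl_near ξ hξ hg0 hp hpm (hg p hp)).2 (q - p)
  have a2 := (vl_near ξ hξ hg0 hq hqm (hg q hq)).2 (p - q)
  have t1 := vl_taylor ξ hξ hK hM hM0 (h0K p hp) (h0K q hq)
  have t2 := vl_taylor ξ hξ hK hM hM0 (h0K q hq) (h0K p hp)
  rw [hp, hq, sub_self, zero_sub, abs_neg] at t1 t2
  rw [dist_eq_norm] at hx hy
  rw [norm_sub_rev q p] at t1
  have b1 : g₀ * |⟪x - p, q - p⟫| ≤ δ * (M * ‖p - q‖ ^ 2) :=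
    a1.trans (mul_le_mul hx t1 (abs_nonneg _) ((norm_nonneg _).trans hx))
  have b2 : g₀ * |⟪y - q, p - q⟫| ≤ δ * (M * ‖p - q‖ ^ 2) :=
    a2.trans (mul_le_mul hy t2 (abs_nonneg _) ((norm_nonneg _).trans hx))
  have b3 : 4 * (δ * (M * ‖p - q‖ ^ 2)) ≤ g₀ * ‖p - q‖ ^ 2 := by nlinarith [sq_nonneg ‖p - q‖]
  have b4 : |⟪x - p, q - p⟫| + |⟪y - q, p - q⟫| ≤ ‖p - q‖ ^ 2 / 2 := by
    by_contra hcon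
    push Not at hcon
    have := mul_lt_mul_of_pos_left hcon hg0
    linarith
  have e : ‖p - q‖ ^ 2 = ⟪x - p, q - p⟫ + ⟪y - q, p - q⟫ + ⟪x - y, p - q⟫ := by
    rw [← real_inner_self_eq_norm_sq]
    simp only [inner_sub_left, inner_sub_right]
    rw [real_inner_comm p q]
    ring
  have c1 := le_abs_self ⟪x - p, q - p⟫
  have c2 := le_abs_self ⟪y - q, p - q⟫
  have c3 := real_inner_le_norm (x - y) (p - q)
  have f : ‖p - q‖ * ‖p - q‖ ≤ ‖p - q‖ * (2 * ‖x - y‖) := by nlinarith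
  rcases (norm_nonneg (p - q)).eq_or_lt with h | h
  · rw [← h]; positivity
  · exact le_of_mul_le_mul_left f h

lemma vl_xi_lower (ξ : E3 → ℝ) (hξ : ContDiff ℝ 3 ξ) {K : Set E3} (hK : Convex ℝ K) {M g₀ δ : ℝ}
    (hM : ∀ x ∈ K, ‖fderiv ℝ (fderiv ℝ ξ) x‖ ≤ M) (hM0 : 0 < M) (hg0 : 0 < g₀)
    (hδ : 4 * M * δ ≤ g₀)
    (hg : ∀ p, ξ p = 0 → g₀ ≤ ‖fderiv ℝ ξ p‖) (h0K : ∀ p, ξ p = 0 → p ∈ K)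
    {x p : E3} (hxK : x ∈ K) (hp : ξ p = 0)
    (hpm : ∀ q, ξ q = 0 → dist x p ≤ dist x q) (hx : dist x p ≤ δ) :
    g₀ * ‖x - p‖ ≤ 2 * |ξ x| := by
  have a1 := (vl_near ξ hξ hg0 hp hpm (hg p hp)).1
  have t := vl_taylor ξ hξ hK hM hM0 (h0K p hp) hxK
  rw [hp, sub_zero] at t
  rw [dist_eq_norm] at hx
  have h1 : |fderiv ℝ ξ p (x - p)| ≤ |ξ x| + |ξ x - fderiv ℝ ξ p (x - p)| := by
    have := abs_sub_abs_le_abs_sub (fderiv ℝ ξ p (x - p)) (ξ x)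
    rw [abs_sub_comm] at this
    linarith
  have h2 : M * ‖x - p‖ ^ 2 ≤ M * δ * ‖x - p‖ := by
    have : ‖x - p‖ * ‖x - p‖ ≤ δ * ‖x - p‖ := by gcongr
    nlinarith
  have h3 : 4 * M * δ * ‖x - p‖ ≤ g₀ * ‖x - p‖ := by gcongr
  nlinarith [norm_nonneg (x - p)]

/-- The square of `β`. -/
def vlPhi (ξ : E3 → ℝ) (Efld : ℝ → E3 → E3) (near : E3 → E3) (t : ℝ) (x v : E3) : ℝ :=
  (fderiv ℝ ξ x v) ^ 2 + ξ x ^ 2 - 2 * (fderiv ℝ (fderiv ℝ ξ) x v v) * ξ x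
    - 2 * (fderiv ℝ ξ (near x) (Efld t (near x))) * ξ x

lemma vl_beta_eq (ξ : E3 → ℝ) (Efld : ℝ → E3 → E3) (near : E3 → E3) (t : ℝ) (x v : E3) :
    betaW ξ Efld near t x v = √(vlPhi ξ Efld near t x v) := by
  unfold betaW vlPhi
  rw [inner_gradient_right, inner_gradient_right, iteratedFDeriv_two_apply]
  simp

structure VLData (ξ : E3 → ℝ) (Ω K : Set E3) (G M T g₀ Cc : ℝ) (Efld : ℝ → E3 → E3)
    (EB ENB ETB CE δ : ℝ) (near : E3 → E3) : Prop where
  hξ : ContDiff ℝ 3 ξ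
  hΩ : Ω = {x | ξ x < 0}
  hfr : frontier Ω = {x | ξ x = 0}
  hK : Convex ℝ K
  hcl : closure Ω ⊆ K
  G0 : 0 < G
  M0 : 0 < M
  T0 : 0 < T
  g0 : 0 < g₀
  Cc0 : 0 < Cc
  hG : ∀ x ∈ K, ‖fderiv ℝ ξ x‖ ≤ G
  hM : ∀ x ∈ K, ‖fderiv ℝ (fderiv ℝ ξ) x‖ ≤ M
  hT : ∀ x ∈ K, ∀ v, |fderiv ℝ (fderiv ℝ (fderiv ℝ ξ)) x v v v| ≤ T * ‖v‖ ^ 3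
  hg : ∀ p, ξ p = 0 → g₀ ≤ ‖fderiv ℝ ξ p‖
  hconv : ∀ x ∈ closure Ω, ∀ v, Cc * ‖v‖ ^ 2 ≤ fderiv ℝ (fderiv ℝ ξ) x v v
  hE : ∀ t x, ‖Efld t x‖ ≤ EB
  dEx : ∀ t : ℝ, Differentiable ℝ (Efld t)
  hEx : ∀ t x, ‖fderiv ℝ (Efld t) x‖ ≤ ENB
  dEt : ∀ x : E3, Differentiable ℝ (fun τ => Efld τ x)
  hEt : ∀ t x, ‖deriv (fun τ => Efld τ x) t‖ ≤ ETB
  CE0 : 0 < CE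
  sgn : ∀ t p, ξ p = 0 → CE * g₀ ≤ fderiv ℝ ξ p (Efld t p)
  hCE : ∀ p, ξ p = 0 → CE ≤ EB
  δ0 : 0 < δ
  hδ : 4 * M * δ ≤ g₀
  hnear : ∀ x ∈ Ω, Metric.infDist x (frontier Ω) < δ →
        near x ∈ frontier Ω ∧ dist x (near x) = Metric.infDist x (frontier Ω)

namespace VLData

variable {ξ : E3 → ℝ} {Ω K : Set E3} {G M T g₀ Cc : ℝ} {Efld : ℝ → E3 → E3}
    {EB ENB ETB CE δ : ℝ} {near : E3 → E3}

lemma EB0 (h : VLData ξ Ω K G M T g₀ Cc Efld EB ENB ETB CE δ near) : 0 ≤ EB :=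
  (norm_nonneg _).trans (h.hE 0 0)

lemma ENB0 (h : VLData ξ Ω K G M T g₀ Cc Efld EB ENB ETB CE δ near) : 0 ≤ ENB :=
  (norm_nonneg _).trans (h.hEx 0 0)

lemma ETB0 (h : VLData ξ Ω K G M T g₀ Cc Efld EB ENB ETB CE δ near) : 0 ≤ ETB :=
  (norm_nonneg _).trans (h.hEt 0 0)

lemma zeroK (h : VLData ξ Ω K G M T g₀ Cc Efld EB ENB ETB CE δ near) {p : E3} (hp : ξ p = 0) :
    p ∈ K := h.hcl (frontier_subset_closure (by rw [h.hfr]; exact hp))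

lemma near0 (h : VLData ξ Ω K G M T g₀ Cc Efld EB ENB ETB CE δ near) {x : E3} (hx : x ∈ Ω)
    (hd : Metric.infDist x (frontier Ω) < δ) : ξ (near x) = 0 := by
  have := (h.hnear x hx hd).1
  rwa [h.hfr] at this

lemma near_min (h : VLData ξ Ω K G M T g₀ Cc Efld EB ENB ETB CE δ near) {x : E3} (hx : x ∈ Ω)
    (hd : Metric.infDist x (frontier Ω) < δ) (q : E3) (hq : ξ q = 0) :
    dist x (near x) ≤ dist x q := by
  rw [(h.hnear x hx hd).2]
  exact Metric.infDist_le_dist_of_mem (by rw [h.hfr]; exact hq)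

lemma near_le (h : VLData ξ Ω K G M T g₀ Cc Efld EB ENB ETB CE δ near) {x : E3} (hx : x ∈ Ω)
    (hd : Metric.infDist x (frontier Ω) < δ) : dist x (near x) ≤ δ := by
  rw [(h.hnear x hx hd).2]; exact hd.le

lemma near_lip (h : VLData ξ Ω K G M T g₀ Cc Efld EB ENB ETB CE δ near) {x y : E3} (hx : x ∈ Ω)
    (hd : Metric.infDist x (frontier Ω) < δ) (hy : y ∈ Ω)
    (hd' : Metric.infDist y (frontier Ω) < δ) : ‖near x - near y‖ ≤ 2 * ‖x - y‖ :=
  vl_near_lip ξ h.hξ h.hK h.hM h.M0 h.g0 h.hδ h.hg (fun _ => h.zeroK) (h.near0 hx hd)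
    (h.near0 hy hd') (h.near_min hx hd) (h.near_min hy hd') (h.near_le hx hd) (h.near_le hy hd')

lemma memK (h : VLData ξ Ω K G M T g₀ Cc Efld EB ENB ETB CE δ near) {x : E3} (hx : x ∈ Ω) :
    x ∈ K := h.hcl (subset_closure hx)

lemma xi_lower (h : VLData ξ Ω K G M T g₀ Cc Efld EB ENB ETB CE δ near) {x : E3} (hx : x ∈ Ω)
    (hd : Metric.infDist x (frontier Ω) < δ) : g₀ * ‖x - near x‖ ≤ 2 * |ξ x| :=
  vl_xi_lower ξ h.hξ h.hK h.hM h.M0 h.g0 h.hδ h.hg (fun _ => h.zeroK) (h.memK hx) (h.near0 hx hd)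
    (h.near_min hx hd) (h.near_le hx hd)

lemma xi_neg (h : VLData ξ Ω K G M T g₀ Cc Efld EB ENB ETB CE δ near) {x : E3} (hx : x ∈ Ω) :
    ξ x < 0 := by
  have := h.hΩ ▸ hx
  exact this

lemma d0 (h : VLData ξ Ω K G M T g₀ Cc Efld EB ENB ETB CE δ near) : Differentiable ℝ ξ :=
  h.hξ.differentiable (by norm_num)

lemma c1 (h : VLData ξ Ω K G M T g₀ Cc Efld EB ENB ETB CE δ near) :
    ContDiff ℝ 2 (fderiv ℝ ξ) := h.hξ.fderiv_right (by norm_num)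

lemma d1 (h : VLData ξ Ω K G M T g₀ Cc Efld EB ENB ETB CE δ near) :
    Differentiable ℝ (fderiv ℝ ξ) := h.c1.differentiable (by norm_num)

lemma c2 (h : VLData ξ Ω K G M T g₀ Cc Efld EB ENB ETB CE δ near) :
    ContDiff ℝ 1 (fderiv ℝ (fderiv ℝ ξ)) := h.c1.fderiv_right (by norm_num)

lemma d2 (h : VLData ξ Ω K G M T g₀ Cc Efld EB ENB ETB CE δ near) :
    Differentiable ℝ (fderiv ℝ (fderiv ℝ ξ)) := h.c2.differentiable (by norm_num)

lemma E_lip (h : VLData ξ Ω K G M T g₀ Cc Efld EB ENB ETB CE δ near) (t s : ℝ) (p q : E3) :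
    ‖Efld t p - Efld s q‖ ≤ ETB * |t - s| + ENB * ‖p - q‖ := by
  have a1 := convex_univ.norm_image_sub_le_of_norm_fderiv_le (𝕜 := ℝ) (f := Efld s)
    (fun x _ => h.dEx s x) (fun x _ => h.hEx s x) (Set.mem_univ q) (Set.mem_univ p)
  have a2 := convex_univ.norm_image_sub_le_of_norm_deriv_le (𝕜 := ℝ) (f := fun τ => Efld τ p)
    (fun x _ => h.dEt p x) (fun x _ => h.hEt x p) (Set.mem_univ s) (Set.mem_univ t)
  rw [Real.norm_eq_abs] at a2
  calc _ = ‖(Efld t p - Efld s p) + (Efld s p - Efld s q)‖ := by congr 1; abel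
    _ ≤ _ := (norm_add_le _ _).trans (add_le_add a2 a1)

lemma Q_lip (h : VLData ξ Ω K G M T g₀ Cc Efld EB ENB ETB CE δ near) (t s : ℝ) {p q : E3}
    (hp : p ∈ K) (hq : q ∈ K) :
    |fderiv ℝ ξ p (Efld t p) - fderiv ℝ ξ q (Efld s q)|
      ≤ G * ETB * |t - s| + (ENB * G + EB * M) * ‖p - q‖ := by
  have a1 : ‖fderiv ℝ ξ p - fderiv ℝ ξ q‖ ≤ M * ‖p - q‖ :=
    h.hK.norm_image_sub_le_of_norm_fderiv_le (fun x _ => h.d1 x) h.hM hq hp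
  have e : fderiv ℝ ξ p (Efld t p) - fderiv ℝ ξ q (Efld s q)
      = fderiv ℝ ξ p (Efld t p - Efld s q) + (fderiv ℝ ξ p - fderiv ℝ ξ q) (Efld s q) := by
    simp
  have b1 : |fderiv ℝ ξ p (Efld t p - Efld s q)| ≤ G * (ETB * |t - s| + ENB * ‖p - q‖) := by
    rw [← Real.norm_eq_abs]
    refine ((fderiv ℝ ξ p).le_opNorm _).trans ?_
    exact mul_le_mul (h.hG p hp) (h.E_lip t s p q) (norm_nonneg _) h.G0.le
  have b2 : |(fderiv ℝ ξ p - fderiv ℝ ξ q) (Efld s q)| ≤ M * ‖p - q‖ * EB := by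
    rw [← Real.norm_eq_abs]
    refine ((fderiv ℝ ξ p - fderiv ℝ ξ q).le_opNorm _).trans ?_
    exact mul_le_mul a1 (h.hE s q) (norm_nonneg _) (mul_nonneg h.M0.le (norm_nonneg _))
  rw [e]
  refine (abs_add_le _ _).trans ((add_le_add b1 b2).trans (le_of_eq ?_))
  ring

lemma phi_lower (h : VLData ξ Ω K G M T g₀ Cc Efld EB ENB ETB CE δ near) {x : E3} (hx : x ∈ Ω)
    (hd : Metric.infDist x (frontier Ω) < δ) (t : ℝ) (v : E3) :
    ξ x ^ 2 ≤ vlPhi ξ Efld near t x v := by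
  have h1 := h.xi_neg hx
  have h2 := h.hconv x (subset_closure hx) v
  have h3 := h.sgn t _ (h.near0 hx hd)
  have h4 : 0 ≤ Cc * ‖v‖ ^ 2 := mul_nonneg h.Cc0.le (sq_nonneg _)
  have h5 : 0 < CE * g₀ := mul_pos h.CE0 h.g0
  unfold vlPhi
  nlinarith [mul_nonneg (h4.trans h2) (neg_nonneg.2 h1.le),
    mul_nonneg (h5.le.trans h3) (neg_nonneg.2 h1.le), sq_nonneg (fderiv ℝ ξ x v)]

lemma phi_pos (h : VLData ξ Ω K G M T g₀ Cc Efld EB ENB ETB CE δ near) {x : E3} (hx : x ∈ Ω)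
    (hd : Metric.infDist x (frontier Ω) < δ) (t : ℝ) (v : E3) :
    0 < vlPhi ξ Efld near t x v :=
  (pow_pos_of_neg (h.xi_neg hx)).trans_le (h.phi_lower hx hd t v)
where
  pow_pos_of_neg {a : ℝ} (ha : a < 0) : 0 < a ^ 2 := by nlinarith

end VLData

set_option maxHeartbeats 1000000 in
/-- The algebraic heart of the velocity lemma. -/
lemma vl_alg {gv Hvv gE Q y n Tv HEv HvE G M T g₀ Cc EB ENB ETB CE d : ℝ}
    (G0 : 0 < G) (M0 : 0 < M) (T0 : 0 < T) (g0 : 0 < g₀) (Cc0 : 0 < Cc) (CE0 : 0 < CE)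
    (EB0 : 0 ≤ EB) (ENB0 : 0 ≤ ENB) (ETB0 : 0 ≤ ETB) (hCE : CE ≤ EB) (hn : 0 ≤ n) (hy : 0 < y)
    (hgv : |gv| ≤ G * n) (hQ : |gE - Q| ≤ (ENB * G + EB * M) * d) (hd : g₀ * d ≤ 2 * y)
    (hT : |Tv| ≤ T * n ^ 3) (h1 : |HEv| ≤ M * EB * n) (h2 : |HvE| ≤ M * EB * n)
    (hH : Cc * n ^ 2 ≤ Hvv) (hs : CE * g₀ ≤ Q) :
    |2 * gv * (Hvv + gE) + 2 * (-y) * gv - 2 * ((Tv + HEv + HvE) * (-y) + Hvv * gv) - 2 * Q * gv|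
      + 2 * y * (G * ETB + (ENB * G + EB * M) * (2 * n))
    ≤ (2 + T / Cc + (2 * G * (G + M) / g₀ + 2 * M + G + 2 * (G + M)) / g₀) *
        (EB + ENB + ETB + 1) / CE * (n + 1) *
      (gv ^ 2 + (-y) ^ 2 - 2 * Hvv * (-y) - 2 * Q * (-y)) := by
  set φ := gv ^ 2 + (-y) ^ 2 - 2 * Hvv * (-y) - 2 * Q * (-y) with hφ
  set S := EB + ENB + ETB + 1 with hS
  have S0 : 0 < S := by positivity
  have Hv0 : 0 ≤ Hvv := le_trans (by positivity) hH
  have Q0 : 0 < Q := lt_of_lt_of_le (by positivity) hs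
  have p1 : 2 * (y * |gv|) ≤ φ := by
    have : 0 ≤ (y - |gv|) ^ 2 := sq_nonneg _
    have e : |gv| ^ 2 = gv ^ 2 := sq_abs gv
    have := mul_nonneg Hv0 hy.le
    have := mul_pos Q0 hy
    nlinarith
  have p2 : 2 * (Cc * n ^ 2 * y) ≤ φ := by
    have := mul_le_mul_of_nonneg_right hH hy.le
    have := mul_pos Q0 hy
    nlinarith [sq_nonneg gv, sq_nonneg y]
  have p3 : 2 * (CE * g₀ * y) ≤ φ := by
    have := mul_le_mul_of_nonneg_right hs hy.le
    have := mul_nonneg Hv0 hy.le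
    nlinarith [sq_nonneg gv, sq_nonneg y]
  have φ0 : 0 < φ := lt_of_lt_of_le (by positivity) p3
  have y1 : y ≤ φ / (2 * CE * g₀) := by rw [le_div_iff₀ (by positivity)]; linarith
  have y2 : y * n ^ 2 ≤ φ / (2 * Cc) := by rw [le_div_iff₀ (by positivity)]; linarith
  have SC : 1 ≤ S / CE := by rw [le_div_iff₀ CE0]; linarith
  have hd' : d ≤ 2 * y / g₀ := by rw [le_div_iff₀ g0]; linarith
  have A1 : ENB * G + EB * M ≤ (G + M) * S := by
    have : ENB ≤ S := by linarith
    have : EB ≤ S := by linarith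
    nlinarith
  have A0 : 0 ≤ ENB * G + EB * M := by positivity
  -- rewrite the derivative after the cancellation
  have e : 2 * gv * (Hvv + gE) + 2 * (-y) * gv - 2 * ((Tv + HEv + HvE) * (-y) + Hvv * gv)
      - 2 * Q * gv = 2 * (gv * (gE - Q)) + (-(2 * (y * gv))) + 2 * (y * Tv)
        + 2 * (y * HEv) + 2 * (y * HvE) := by ring
  have t1 : |2 * (gv * (gE - Q))| ≤ 2 * G * (G + M) / g₀ / g₀ * (S / CE) * n * φ := by
    rw [abs_mul, abs_mul, abs_two]
    calc 2 * (|gv| * |gE - Q|) ≤ 2 * ((G * n) * (((G + M) * S) * (2 * y / g₀))) := by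
          gcongr
          refine hQ.trans ?_
          refine (mul_le_mul_of_nonneg_left hd' A0).trans ?_
          gcongr
      _ ≤ 2 * ((G * n) * (((G + M) * S) * (2 * (φ / (2 * CE * g₀)) / g₀))) := by gcongr
      _ = _ := by field_simp
  have t2 : |-(2 * (y * gv))| ≤ 2 * (S / CE) * φ := by
    rw [abs_neg, abs_mul, abs_mul, abs_two, abs_of_pos hy]
    have k : 1 * φ ≤ S / CE * φ := mul_le_mul_of_nonneg_right SC φ0.le
    calc 2 * (y * |gv|) ≤ φ := p1
      _ ≤ 2 * (S / CE * φ) := by linarith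
      _ = _ := by ring
  have t3 : |2 * (y * Tv)| ≤ T / Cc * (S / CE) * n * φ := by
    rw [abs_mul, abs_mul, abs_two, abs_of_pos hy]
    calc 2 * (y * |Tv|) ≤ 2 * (y * (T * n ^ 3)) := by gcongr
      _ = 2 * T * n * (y * n ^ 2) := by ring
      _ ≤ 2 * T * n * (φ / (2 * Cc)) := by gcongr
      _ = T / Cc * 1 * n * φ := by field_simp
      _ ≤ _ := by gcongr
  have t4 : ∀ z, |z| ≤ M * EB * n → |2 * (y * z)| ≤ M / g₀ * (S / CE) * n * φ := by
    intro z hz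
    rw [abs_mul, abs_mul, abs_two, abs_of_pos hy]
    have : EB ≤ S := by linarith
    calc 2 * (y * |z|) ≤ 2 * ((φ / (2 * CE * g₀)) * (M * S * n)) := by
          gcongr
          exact hz.trans (by gcongr)
      _ = _ := by field_simp
  have t5 : 2 * y * (G * ETB + (ENB * G + EB * M) * (2 * n))
      ≤ G / g₀ * (S / CE) * φ + 2 * (G + M) / g₀ * (S / CE) * n * φ := by
    have : ETB ≤ S := by linarith
    calc _ ≤ 2 * (φ / (2 * CE * g₀)) * (G * S + ((G + M) * S) * (2 * n)) := by gcongr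
      _ = _ := by field_simp
  have tri : |2 * (gv * (gE - Q)) + (-(2 * (y * gv))) + 2 * (y * Tv)
        + 2 * (y * HEv) + 2 * (y * HvE)| ≤ |2 * (gv * (gE - Q))| + |(-(2 * (y * gv)))|
        + |2 * (y * Tv)| + |2 * (y * HEv)| + |2 * (y * HvE)| := by
    refine (abs_add_le _ _).trans (add_le_add_left ?_ _)
    refine (abs_add_le _ _).trans (add_le_add_left ?_ _)
    refine (abs_add_le _ _).trans (add_le_add_left ?_ _)
    exact (abs_add_le _ _)
  rw [e]
  have s4 := t4 _ h1
  have s5 := t4 _ h2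
  set B := S / CE * φ with hB
  have B0 : 0 < B := by positivity
  have fin : (2 + T / Cc + (2 * G * (G + M) / g₀ + 2 * M + G + 2 * (G + M)) / g₀) *
        S / CE * (n + 1) * φ
      = (2 * (S / CE) * φ + T / Cc * (S / CE) * n * φ + 2 * G * (G + M) / g₀ / g₀ * (S / CE) * n * φ
        + 2 * (M / g₀ * (S / CE) * n * φ) + G / g₀ * (S / CE) * φ
        + 2 * (G + M) / g₀ * (S / CE) * n * φ)
       + (2 * n + T / Cc + 2 * G * (G + M) / g₀ / g₀ + 2 * M / g₀ + G / g₀ * n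
        + 2 * (G + M) / g₀) * B := by
    rw [hB]; field_simp; ring
  have rest : 0 ≤ (2 * n + T / Cc + 2 * G * (G + M) / g₀ / g₀ + 2 * M / g₀ + G / g₀ * n
        + 2 * (G + M) / g₀) * B := by positivity
  rw [fin]
  linarith

namespace VLData

open Filter Topology

variable {ξ : E3 → ℝ} {Ω K : Set E3} {G M T g₀ Cc : ℝ} {Efld : ℝ → E3 → E3}
    {EB ENB ETB CE δ : ℝ} {near : E3 → E3}

lemma isOpen (h : VLData ξ Ω K G M T g₀ Cc Efld EB ENB ETB CE δ near) : IsOpen Ω := by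
  rw [h.hΩ]; exact isOpen_lt h.hξ.continuous continuous_const

lemma mem_cases (h : VLData ξ Ω K G M T g₀ Cc Efld EB ENB ETB CE δ near) {x : E3}
    (hx : x ∈ closure Ω) : x ∈ Ω ∨ ξ x = 0 := by
  by_cases hm : x ∈ Ω
  · exact Or.inl hm
  · right
    have : x ∈ frontier Ω := by
      rw [h.isOpen.frontier_eq]; exact ⟨hx, hm⟩
    rwa [h.hfr] at this

lemma ev_layer (h : VLData ξ Ω K G M T g₀ Cc Efld EB ENB ETB CE δ near) {x : E3} (hx : x ∈ Ω)
    (hd : Metric.infDist x (frontier Ω) < δ) :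
    ∀ᶠ y in 𝓝 x, y ∈ Ω ∧ Metric.infDist y (frontier Ω) < δ :=
  Filter.Eventually.and (h.isOpen.mem_nhds hx)
    ((Metric.continuous_infDist_pt (frontier Ω)).continuousAt.eventually_lt_const hd)

/-- Away from the boundary layer `α` is locally constant. -/
lemma far (h : VLData ξ Ω K G M T g₀ Cc Efld EB ENB ETB CE δ near) {δ' Cδ : ℝ} {χ : ℝ → ℝ}
    (hδ'0 : 0 < δ')
    (hδ' : δ' = sInf {r : ℝ | ∃ x ∈ Ω, Metric.infDist x (frontier Ω) = δ ∧ r = |ξ x|})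
    (h2 : ∀ s : ℝ, δ' / 2 ≤ s → χ s = Cδ) {x : E3} (hx : x ∈ closure Ω)
    (hd : δ ≤ Metric.infDist x (frontier Ω)) :
    ∀ᶠ y in 𝓝 x, ∀ t v, alphaW ξ Ω Efld near χ δ Cδ t y v = Cδ := by
  have hxΩ : x ∈ Ω := by
    rcases h.mem_cases hx with h' | h'
    · exact h'
    · have : x ∈ frontier Ω := by rw [h.hfr]; exact h'
      rw [Metric.infDist_zero_of_mem this] at hd
      exact absurd h.δ0 (not_lt.2 hd)
  rcases hd.lt_or_eq with hlt | heq
  · filter_upwards [(Metric.continuous_infDist_pt (frontier Ω)).continuousAt.eventually_const_lt hlt]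
      with y hy t v
    rw [alphaW, if_neg (not_lt.2 hy.le)]
  · have hb : δ' ≤ |ξ x| := by
      rw [hδ']
      exact csInf_le ⟨0, by rintro r ⟨y, -, -, rfl⟩; exact abs_nonneg _⟩ ⟨x, hxΩ, heq.symm, rfl⟩
    have hc : ContinuousAt (fun y => |ξ y|) x := h.hξ.continuous.abs.continuousAt
    filter_upwards [h.isOpen.mem_nhds hxΩ, hc.eventually_const_lt (show δ' / 2 < |ξ x| by linarith)]
      with y hy hy2 t v
    rw [alphaW]
    split_ifs with hif
    · rw [vl_beta_eq]
      apply h2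
      refine hy2.le.trans ?_
      rw [← Real.sqrt_sq_eq_abs]
      exact Real.sqrt_le_sqrt (h.phi_lower hy hif t v)
    · rfl

lemma cont_Q (h : VLData ξ Ω K G M T g₀ Cc Efld EB ENB ETB CE δ near) (q₀ : ℝ × E3 × E3)
    (hx : q₀.2.1 ∈ closure Ω) (hd : Metric.infDist q₀.2.1 (frontier Ω) < δ) :
    ContinuousWithinAt (fun q : ℝ × E3 × E3 =>
      fderiv ℝ ξ (near q.2.1) (Efld q.1 (near q.2.1)) * ξ q.2.1)
      (Set.univ ×ˢ closure Ω ×ˢ (Set.univ : Set E3)) q₀ := by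
  have cξ : Continuous (fun q : ℝ × E3 × E3 => ξ q.2.1) := h.hξ.continuous.comp (by fun_prop)
  rcases h.mem_cases hx with hΩ | h0
  · refine ContinuousAt.continuousWithinAt ?_
    refine ContinuousAt.mul ?_ cξ.continuousAt
    have hc : Continuous (fun q : ℝ × E3 × E3 => q.2.1) := by fun_prop
    have ev := hc.continuousAt.eventually (h.ev_layer hΩ hd)
    rw [ContinuousAt, tendsto_iff_norm_sub_tendsto_zero]
    have lim : Tendsto (fun q : ℝ × E3 × E3 => G * ETB * |q.1 - q₀.1|
        + (ENB * G + EB * M) * (2 * ‖q.2.1 - q₀.2.1‖)) (𝓝 q₀) (𝓝 0) := by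
      have : Continuous (fun q : ℝ × E3 × E3 => G * ETB * |q.1 - q₀.1|
        + (ENB * G + EB * M) * (2 * ‖q.2.1 - q₀.2.1‖)) := by fun_prop
      simpa using this.tendsto q₀
    refine squeeze_zero' (Eventually.of_forall fun _ => norm_nonneg _) ?_ lim
    filter_upwards [ev] with q hq
    refine (h.Q_lip q.1 q₀.1 (h.zeroK (h.near0 hq.1 hq.2)) (h.zeroK (h.near0 hΩ hd))).trans ?_
    have := h.near_lip hq.1 hq.2 hΩ hd
    have A0 : 0 ≤ ENB * G + EB * M :=
      add_nonneg (mul_nonneg h.ENB0 h.G0.le) (mul_nonneg h.EB0 h.M0.le)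
    gcongr
  · rw [ContinuousWithinAt, h0, mul_zero]
    have lim : Tendsto (fun q : ℝ × E3 × E3 => G * EB * |ξ q.2.1|)
        (𝓝[Set.univ ×ˢ closure Ω ×ˢ (Set.univ : Set E3)] q₀) (𝓝 0) := by
      have : Continuous (fun q : ℝ × E3 × E3 => G * EB * |ξ q.2.1|) := continuous_const.mul cξ.abs
      have := this.continuousWithinAt (s := Set.univ ×ˢ closure Ω ×ˢ (Set.univ : Set E3)) (x := q₀)
      simpa [ContinuousWithinAt, h0] using this
    refine squeeze_zero_norm' ?_ lim
    have hc : Continuous (fun q : ℝ × E3 × E3 => Metric.infDist q.2.1 (frontier Ω)) :=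
      (Metric.continuous_infDist_pt (frontier Ω)).comp (by fun_prop)
    filter_upwards [self_mem_nhdsWithin,
      hc.continuousWithinAt.eventually_lt_const hd] with q hq hqd
    rw [norm_mul, Real.norm_eq_abs (ξ _)]
    rcases h.mem_cases hq.2.1 with hΩ | h0'
    · gcongr
      refine (ContinuousLinearMap.le_opNorm _ _).trans ?_
      exact mul_le_mul (h.hG _ (h.zeroK (h.near0 hΩ hqd))) (h.hE _ _) (norm_nonneg _) h.G0.le
    · rw [h0']; simp

lemma cont_phi (h : VLData ξ Ω K G M T g₀ Cc Efld EB ENB ETB CE δ near) (q₀ : ℝ × E3 × E3)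
    (hx : q₀.2.1 ∈ closure Ω) (hd : Metric.infDist q₀.2.1 (frontier Ω) < δ) :
    ContinuousWithinAt (fun q : ℝ × E3 × E3 => vlPhi ξ Efld near q.1 q.2.1 q.2.2)
      (Set.univ ×ˢ closure Ω ×ˢ (Set.univ : Set E3)) q₀ := by
  have cQ := h.cont_Q q₀ hx hd
  have k0 := h.hξ.continuous
  have k1 := h.c1.continuous
  have k2 := h.c2.continuous
  have cP : Continuous (fun q : ℝ × E3 × E3 => (fderiv ℝ ξ q.2.1 q.2.2) ^ 2 + ξ q.2.1 ^ 2
      - 2 * (fderiv ℝ (fderiv ℝ ξ) q.2.1 q.2.2 q.2.2) * ξ q.2.1) := by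
    have l1 : Continuous (fun q : ℝ × E3 × E3 => fderiv ℝ ξ q.2.1 q.2.2) :=
      (k1.comp (by fun_prop : Continuous fun q : ℝ × E3 × E3 => q.2.1)).clm_apply (by fun_prop)
    have l2 : Continuous (fun q : ℝ × E3 × E3 => fderiv ℝ (fderiv ℝ ξ) q.2.1 q.2.2 q.2.2) :=
      ((k2.comp (by fun_prop : Continuous fun q : ℝ × E3 × E3 => q.2.1)).clm_apply
        (by fun_prop)).clm_apply (by fun_prop)
    have l3 : Continuous (fun q : ℝ × E3 × E3 => ξ q.2.1) := k0.comp (by fun_prop)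
    fun_prop
  have := cP.continuousWithinAt.sub (continuousWithinAt_const (b := (2 : ℝ)).mul cQ)
  refine this.congr (fun q _ => ?_) ?_ <;> simp only [vlPhi, Pi.sub_apply, Pi.mul_apply] <;> ring

lemma cont_alpha (h : VLData ξ Ω K G M T g₀ Cc Efld EB ENB ETB CE δ near) {δ' Cδ : ℝ} {χ : ℝ → ℝ}
    (hδ'0 : 0 < δ')
    (hδ' : δ' = sInf {r : ℝ | ∃ x ∈ Ω, Metric.infDist x (frontier Ω) = δ ∧ r = |ξ x|})
    (hχ : Continuous χ)
    (h2 : ∀ s : ℝ, δ' / 2 ≤ s → χ s = Cδ) :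
    ContinuousOn (fun q : ℝ × E3 × E3 => alphaW ξ Ω Efld near χ δ Cδ q.1 q.2.1 q.2.2)
        (Set.univ ×ˢ closure Ω ×ˢ (Set.univ : Set E3)) := by
  intro q₀ hq₀
  have hx : q₀.2.1 ∈ closure Ω := hq₀.2.1
  rcases lt_or_ge (Metric.infDist q₀.2.1 (frontier Ω)) δ with hd | hd
  · have hc : Continuous (fun q : ℝ × E3 × E3 => Metric.infDist q.2.1 (frontier Ω)) :=
      (Metric.continuous_infDist_pt (frontier Ω)).comp (by fun_prop)
    have := (hχ.comp Real.continuous_sqrt).continuousAt.comp_continuousWithinAt (h.cont_phi q₀ hx hd)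
    refine this.congr_of_eventuallyEq ?_ ?_
    · filter_upwards [hc.continuousWithinAt.eventually_lt_const hd] with q hq
      rw [alphaW, if_pos hq, vl_beta_eq]; rfl
    · rw [alphaW, if_pos hd, vl_beta_eq]; rfl
  · have ev := h.far hδ'0 hδ' h2 hx hd
    have hc : Continuous (fun q : ℝ × E3 × E3 => q.2.1) := by fun_prop
    have ev2 := hc.continuousAt.eventually ev
    refine ContinuousAt.continuousWithinAt ?_
    refine (continuousAt_const (y := Cδ)).congr ?_
    filter_upwards [ev2] with q hq
    exact (hq q.1 q.2.2).symm

lemma alpha_pos (h : VLData ξ Ω K G M T g₀ Cc Efld EB ENB ETB CE δ near) {δ' Cδ : ℝ} {χ : ℝ → ℝ}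
    (hδ'0 : 0 < δ') (hCδ : 0 < Cδ)
    (h1 : ∀ s : ℝ, 0 ≤ s → s ≤ δ' / 4 → χ s = s)
    (h2 : ∀ s : ℝ, δ' / 2 ≤ s → χ s = Cδ)
    (h3 : MonotoneOn χ (Set.Icc (δ' / 4) (δ' / 2))) {x : E3} (hx : x ∈ Ω) (t : ℝ) (v : E3) :
    0 < alphaW ξ Ω Efld near χ δ Cδ t x v := by
  rw [alphaW]
  split_ifs with hd
  · rw [vl_beta_eq]
    exact vl_chi_pos hδ'0 h1 h2 h3 (Real.sqrt_pos.2 (h.phi_pos hx hd t v))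
  · exact hCδ

set_option maxSynthPendingDepth 4 in
/-- One-sided derivative estimate for `β²` along a characteristic. -/
lemma slope_phi (h : VLData ξ Ω K G M T g₀ Cc Efld EB ENB ETB CE δ near) {X V : ℝ → E3} {τ : ℝ}
    (hX : HasDerivAt X (V τ) τ) (hV : HasDerivAt V (Efld τ (X τ)) τ) (hx : X τ ∈ Ω)
    (hd : Metric.infDist (X τ) (frontier Ω) < δ) :
    ∃ (u : ℝ → ℝ) (R : ℝ), Tendsto u (𝓝[>] τ) (𝓝 R) ∧
      (∀ᶠ z in 𝓝[>] τ, |vlPhi ξ Efld near z (X z) (V z) - vlPhi ξ Efld near τ (X τ) (V τ)|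
        ≤ u z * (z - τ)) ∧
      R ≤ (2 + T / Cc + (2 * G * (G + M) / g₀ + 2 * M + G + 2 * (G + M)) / g₀) *
        (EB + ENB + ETB + 1) / CE * (‖V τ‖ + 1) * vlPhi ξ Efld near τ (X τ) (V τ) := by
  have A0 : 0 ≤ ENB * G + EB * M :=
    add_nonneg (mul_nonneg h.ENB0 h.G0.le) (mul_nonneg h.EB0 h.M0.le)
  set Q := fderiv ℝ ξ (near (X τ)) (Efld τ (near (X τ))) with hQ
  set x := X τ with hxdef
  set v := V τ with hvdef
  set e := Efld τ x with hedef
  have dξ : HasDerivAt (fun z => ξ (X z)) (fderiv ℝ ξ x v) τ :=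
    (h.d0 x).hasFDerivAt.comp_hasDerivAt τ hX
  have dg : HasDerivAt (fun z => fderiv ℝ ξ (X z)) (fderiv ℝ (fderiv ℝ ξ) x v) τ :=
    (h.d1 x).hasFDerivAt.comp_hasDerivAt τ hX
  have dH : HasDerivAt (fun z => fderiv ℝ (fderiv ℝ ξ) (X z))
      (fderiv ℝ (fderiv ℝ (fderiv ℝ ξ)) x v) τ :=
    (h.d2 x).hasFDerivAt.comp_hasDerivAt τ hX
  have dgv := dg.clm_apply hV
  have dHvv := (dH.clm_apply hV).clm_apply hV
  have dP := (((dgv.pow 2).add (dξ.pow 2)).sub ((dHvv.const_mul 2).mul dξ)).sub (dξ.const_mul (2 * Q))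
  set P : ℝ → ℝ := fun z => (fderiv ℝ ξ (X z) (V z)) ^ 2 + ξ (X z) ^ 2
    - 2 * (fderiv ℝ (fderiv ℝ ξ) (X z) (V z) (V z)) * ξ (X z) - 2 * Q * ξ (X z) with hP
  set D := 2 * fderiv ℝ ξ x v * (fderiv ℝ (fderiv ℝ ξ) x v v + fderiv ℝ ξ x e)
    + 2 * (-(-ξ x)) * fderiv ℝ ξ x v
    - 2 * ((fderiv ℝ (fderiv ℝ (fderiv ℝ ξ)) x v v v + fderiv ℝ (fderiv ℝ ξ) x e v
      + fderiv ℝ (fderiv ℝ ξ) x v e) * (-(-ξ x)) + fderiv ℝ (fderiv ℝ ξ) x v v * fderiv ℝ ξ x v)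
    - 2 * Q * fderiv ℝ ξ x v with hD
  have dP' : HasDerivAt P D τ := by
    refine HasDerivAt.congr_deriv dP ?_
    simp only [hD, add_apply, ← hxdef, ← hvdef]
    simp
    ring
  refine ⟨fun z => |slope P τ z| + 2 * |ξ (X z)| * (G * ETB + (ENB * G + EB * M) *
    (2 * ‖slope X τ z‖)), |D| + 2 * |ξ x| * (G * ETB + (ENB * G + EB * M) * (2 * ‖v‖)), ?_, ?_, ?_⟩
  · have s1 : Tendsto (slope P τ) (𝓝[>] τ) (𝓝 D) :=
      (hasDerivAt_iff_tendsto_slope.1 dP').mono_left (nhdsWithin_mono _ (fun z hz => ne_of_gt hz))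
    have s2 : Tendsto (slope X τ) (𝓝[>] τ) (𝓝 v) :=
      (hasDerivAt_iff_tendsto_slope.1 hX).mono_left (nhdsWithin_mono _ (fun z hz => ne_of_gt hz))
    have s3 : Tendsto (fun z => ξ (X z)) (𝓝[>] τ) (𝓝 (ξ x)) :=
      dξ.continuousAt.tendsto.mono_left nhdsWithin_le_nhds
    exact s1.abs.add ((s3.abs.const_mul 2).mul
      (((s2.norm.const_mul 2).const_mul _).const_add _))
  · have ev := (hX.continuousAt.eventually (h.ev_layer hx hd)).filter_mono
      (nhdsWithin_le_nhds (s := Set.Ioi τ))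
    filter_upwards [ev, self_mem_nhdsWithin] with z hz hzτ
    have hzτ' : 0 < z - τ := sub_pos.2 hzτ
    have q1 := h.Q_lip z τ (h.zeroK (h.near0 hz.1 hz.2)) (h.zeroK (h.near0 hx hd))
    have q2 := h.near_lip hz.1 hz.2 hx hd
    have q3 : |fderiv ℝ ξ (near (X z)) (Efld z (near (X z))) - Q| ≤
        (G * ETB + (ENB * G + EB * M) * (2 * ‖slope X τ z‖)) * (z - τ) := by
      refine q1.trans ?_
      have e1 : ‖slope X τ z‖ * (z - τ) = ‖X z - x‖ := by
        rw [slope_def_module, norm_smul, norm_inv, Real.norm_eq_abs, abs_of_pos hzτ']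
        field_simp
        rfl
      have e2 : (G * ETB + (ENB * G + EB * M) * (2 * ‖slope X τ z‖)) * (z - τ)
        = G * ETB * (z - τ) + (ENB * G + EB * M) * (2 * (‖slope X τ z‖ * (z - τ))) := by ring
      rw [e2, e1, abs_of_pos hzτ']
      gcongr
    have e3 : vlPhi ξ Efld near z (X z) (V z) - vlPhi ξ Efld near τ x v
        = (P z - P τ) - 2 * ξ (X z) * (fderiv ℝ ξ (near (X z)) (Efld z (near (X z))) - Q) := by
      simp only [vlPhi, hP, ← hxdef, ← hvdef, ← hQ]
      ring
    have e4 : |P z - P τ| = |slope P τ z| * (z - τ) := by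
      rw [slope_def_field, abs_div, abs_of_pos hzτ']
      field_simp
    rw [e3]
    refine (abs_sub _ _).trans ?_
    rw [e4, abs_mul, abs_mul, abs_two, add_mul]
    rw [mul_assoc (2 * |ξ (X z)|)]
    gcongr
  · have hxi := h.xi_neg hx
    have hxK := h.memK hx
    have hM2 : ∀ a b : E3, |fderiv ℝ (fderiv ℝ ξ) x a b| ≤ M * ‖a‖ * ‖b‖ := by
      intro a b
      rw [← Real.norm_eq_abs]
      refine ((fderiv ℝ (fderiv ℝ ξ) x a).le_opNorm b).trans ?_
      gcongr
      refine ((fderiv ℝ (fderiv ℝ ξ) x).le_opNorm a).trans ?_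
      gcongr
      exact h.hM x hxK
    have heb : ‖e‖ ≤ EB := h.hE τ x
    have hql := h.Q_lip τ τ hxK (h.zeroK (h.near0 hx hd))
    rw [sub_self, abs_zero, mul_zero, zero_add] at hql
    have lower := h.xi_lower hx hd
    rw [abs_of_neg hxi] at lower ⊢
    have := vl_alg (gv := fderiv ℝ ξ x v) (Hvv := fderiv ℝ (fderiv ℝ ξ) x v v)
      (gE := fderiv ℝ ξ x e) (Q := Q) (y := -ξ x) (n := ‖v‖)
      (Tv := fderiv ℝ (fderiv ℝ (fderiv ℝ ξ)) x v v v) (HEv := fderiv ℝ (fderiv ℝ ξ) x e v)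
      (HvE := fderiv ℝ (fderiv ℝ ξ) x v e) (d := ‖x - near x‖)
      h.G0 h.M0 h.T0 h.g0 h.Cc0 h.CE0 h.EB0 h.ENB0 h.ETB0 (h.hCE _ (h.near0 hx hd)) (norm_nonneg v)
      (by linarith) ?_ hql lower (h.hT x hxK v) ?_ ?_ (h.hconv x (subset_closure hx) v)
      (h.sgn τ _ (h.near0 hx hd))
    · refine this.trans (le_of_eq ?_)
      simp only [vlPhi, neg_neg, ← hQ]
    · rw [← Real.norm_eq_abs]
      refine ((fderiv ℝ ξ x).le_opNorm v).trans ?_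
      gcongr
      exact h.hG x hxK
    · refine (hM2 e v).trans ?_
      have := h.M0.le
      gcongr
    · refine (hM2 v e).trans ?_
      have := h.M0.le
      calc M * ‖v‖ * ‖e‖ ≤ M * ‖v‖ * EB := by gcongr
        _ = _ := by ring

end VLData

lemma vl_gronwall_aux {f W : ℝ → ℝ} {s t C : ℝ} (hst : s < t)
    (hf : ContinuousOn f (Set.Icc s t)) (hW : ContinuousOn W (Set.Icc s t))
    (bound : ∀ x ∈ Set.Ico s t, ∀ r, C * W x < r →
      ∀ᶠ z in nhdsWithin x (Set.Ioi x), f z - f x < r * (z - x)) :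
    f t - f s ≤ C * ∫ τ in s..t, W τ := by
  set W' : ℝ → ℝ := fun τ => W (max s (min τ t)) with hW'
  have cW' : Continuous W' := by
    refine hW.comp_continuous (by fun_prop) (fun τ => ⟨le_max_left _ _, ?_⟩)
    exact max_le hst.le (min_le_right _ _)
  have eqW : ∀ τ ∈ Set.Icc s t, W' τ = W τ := by
    intro τ hτ
    simp only [hW']
    rw [min_eq_left hτ.2, max_eq_right hτ.1]
  have eqI : ∫ τ in s..t, W τ = ∫ τ in s..t, W' τ := by
    refine intervalIntegral.integral_congr (fun τ hτ => ?_)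
    rw [Set.uIcc_of_le hst.le] at hτ
    exact (eqW τ hτ).symm
  have dB : ∀ x, HasDerivAt (fun x => f s + C * ∫ τ in s..x, W' τ) (C * W' x) x := fun x =>
    ((intervalIntegral.integral_hasDerivAt_right (cW'.intervalIntegrable _ _)
      (cW'.stronglyMeasurableAtFilter _ _) cW'.continuousAt).const_mul C).const_add _
  have := image_le_of_liminf_slope_right_le_deriv_boundary (f := f) hf
    (B := fun x => f s + C * ∫ τ in s..x, W' τ) (B' := fun x => C * W' x) (by simp)
    (fun x _ => (dB x).continuousAt.continuousWithinAt) (fun x _ => (dB x).hasDerivWithinAt)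
    (fun x hx r hr => ?_) (Set.right_mem_Icc.2 hst.le)
  · rw [eqI]; linarith
  · simp only [eqW x ⟨hx.1, hx.2.le⟩] at hr
    refine Filter.Eventually.frequently ?_
    filter_upwards [bound x hx r hr, self_mem_nhdsWithin] with z hz hzx
    rw [slope_def_field, div_lt_iff₀ (sub_pos.2 hzx)]
    exact hz

lemma vl_gronwall {f W : ℝ → ℝ} {s t C : ℝ} (hst : s < t)
    (hf : ContinuousOn f (Set.Icc s t)) (hW : ContinuousOn W (Set.Icc s t))
    (bound : ∀ x ∈ Set.Ico s t, ∀ r, C * W x < r →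
      ∀ᶠ z in nhdsWithin x (Set.Ioi x), |f z - f x| < r * (z - x)) :
    |f t - f s| ≤ C * ∫ τ in s..t, W τ := by
  rw [abs_le]
  constructor
  · have := vl_gronwall_aux (f := fun x => - f x) hst hf.neg hW (fun x hx r hr => by
      filter_upwards [bound x hx r hr] with z hz
      have := neg_abs_le (f z - f x)
      linarith)
    linarith
  · exact vl_gronwall_aux hst hf hW (fun x hx r hr => by
      filter_upwards [bound x hx r hr] with z hz
      exact (le_abs_self _).trans_lt hz)

open Filter Topology in
lemma VLData.slope_alpha {ξ : E3 → ℝ} {Ω K : Set E3} {G M T g₀ Cc : ℝ} {Efld : ℝ → E3 → E3}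
    {EB ENB ETB CE δ : ℝ} {near : E3 → E3}
    (h : VLData ξ Ω K G M T g₀ Cc Efld EB ENB ETB CE δ near) {δ' Cδ : ℝ} {χ : ℝ → ℝ}
    (hδ'0 : 0 < δ')
    (hδ' : δ' = sInf {r : ℝ | ∃ x ∈ Ω, Metric.infDist x (frontier Ω) = δ ∧ r = |ξ x|})
    (hχ : Differentiable ℝ χ)
    (h1 : ∀ s : ℝ, 0 ≤ s → s ≤ δ' / 4 → χ s = s)
    (h2 : ∀ s : ℝ, δ' / 2 ≤ s → χ s = Cδ)
    (h3 : MonotoneOn χ (Set.Icc (δ' / 4) (δ' / 2)))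
    (h4 : ∀ s : ℝ, deriv χ s ≤ 1)
    {X V : ℝ → E3} {τ : ℝ}
    (hX : HasDerivAt X (V τ) τ) (hV : HasDerivAt V (Efld τ (X τ)) τ) (hx : X τ ∈ Ω)
    (hF : ContinuousAt X τ) {C r : ℝ}
    (hC : (2 + T / Cc + (2 * G * (G + M) / g₀ + 2 * M + G + 2 * (G + M)) / g₀) *
        (EB + ENB + ETB + 1) / CE ≤ C) (hC0 : 0 ≤ C) (hr : C * (‖V τ‖ + 1) < r) :
    ∀ᶠ z in 𝓝[>] τ, |log (alphaW ξ Ω Efld near χ δ Cδ z (X z) (V z))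
      - log (alphaW ξ Ω Efld near χ δ Cδ τ (X τ) (V τ))| < r * (z - τ) := by
  have hr0 : 0 < r := lt_of_le_of_lt (by positivity) hr
  rcases lt_or_ge (Metric.infDist (X τ) (frontier Ω)) δ with hd | hd
  · obtain ⟨u, R, hu, hub, hR⟩ := h.slope_phi hX hV hx hd
    set F : ℝ → ℝ := fun z => vlPhi ξ Efld near z (X z) (V z) with hFdef
    have Fpos : 0 < F τ := h.phi_pos hx hd _ _
    have ev := (hF.eventually (h.ev_layer hx hd)).filter_mono
      (nhdsWithin_le_nhds (s := Set.Ioi τ))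
    have cF : Tendsto F (𝓝[>] τ) (𝓝 (F τ)) := by
      rw [tendsto_iff_norm_sub_tendsto_zero]
      have l : Tendsto (fun z => u z * (z - τ)) (𝓝[>] τ) (𝓝 0) := by
        have : Tendsto (fun z => z - τ) (𝓝[>] τ) (𝓝 0) := by
          have : Continuous fun z => z - τ := by fun_prop
          have := (this.tendsto τ).mono_left (nhdsWithin_le_nhds (s := Set.Ioi τ))
          simpa using this
        simpa using hu.mul this
      exact squeeze_zero' (Eventually.of_forall fun _ => norm_nonneg _) hub l
    have lim : Tendsto (fun z => u z / min (F τ) (F z)) (𝓝[>] τ) (𝓝 (R / F τ)) := by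
      have m : Tendsto (fun z => min (F τ) (F z)) (𝓝[>] τ) (𝓝 (F τ)) := by
        simpa using (tendsto_const_nhds (x := F τ)).min cF
      exact hu.div m Fpos.ne'
    have hlt : R / F τ < r := by
      refine lt_of_le_of_lt ?_ hr
      rw [div_le_iff₀ Fpos]
      refine hR.trans ?_
      gcongr
    filter_upwards [ev, hub, lim.eventually_lt_const hlt, self_mem_nhdsWithin] with z hz hz2 hz3 hzτ
    have hzτ' : 0 < z - τ := sub_pos.2 hzτ
    have Fz : 0 < F z := h.phi_pos hz.1 hz.2 _ _
    rw [alphaW, if_pos hz.2, alphaW, if_pos hd, vl_beta_eq, vl_beta_eq]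
    have k := vl_chi_log hδ'0 hχ h1 h2 h3 h4 Fpos Fz
    refine k.trans_lt ?_
    have mp : 0 < min (F τ) (F z) := lt_min Fpos Fz
    calc |F z - F τ| / min (F τ) (F z) ≤ u z * (z - τ) / min (F τ) (F z) := by gcongr
      _ = u z / min (F τ) (F z) * (z - τ) := by ring
      _ < r * (z - τ) := by gcongr
  · have ev := h.far hδ'0 hδ' h2 (subset_closure hx) hd
    have e0 := ev.self_of_nhds τ (V τ)
    have ev2 := (hF.eventually ev).filter_mono (nhdsWithin_le_nhds (s := Set.Ioi τ))
    filter_upwards [ev2, self_mem_nhdsWithin] with z hz hzτ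
    rw [hz z (V z), e0, sub_self, abs_zero]
    exact mul_pos hr0 (sub_pos.2 hzτ)

/-- **Lemma 2.7 (velocity lemma near the boundary).**
If `E` is bounded with bounded derivatives and satisfies the sign condition
`E(t,x)·n(x) > C_E > 0` on `∂Ω`, then (for small enough boundary layer width `δ`)
the function `α` is continuous and almost invariant along characteristics:
`e^{−C∫ₛᵗ(|V|+1)} α(s,X(s),V(s)) ≤ α(t,X(t),V(t)) ≤ e^{C∫ₛᵗ(|V|+1)} α(s,X(s),V(s))`
for any `C ≥ C_ξ(‖E‖_∞+‖∇E‖_∞+‖∂_tE‖_∞+1)/C_E` with `C_ξ` depending only on `ξ`. -/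
theorem lemma_2_7_velocity_lemma
    (ξ : E3 → ℝ) (hξ : ContDiff ℝ 3 ξ)
    (Ω : Set E3) (hΩ : Ω = {x | ξ x < 0}) (hbd : Bornology.IsBounded Ω)
    (hfr : frontier Ω = {x | ξ x = 0})
    (Cc : ℝ) (hCc : 0 < Cc)
    (hconv : ∀ x ∈ closure Ω, ∀ ζ : E3, Cc * ‖ζ‖ ^ 2 ≤ iteratedFDeriv ℝ 2 ξ x ![ζ, ζ])
    (hgrad : ∃ ε > 0, ∀ x : E3, |ξ x| < ε → gradient ξ x ≠ 0) :
    ∃ Cξ > 0, -- a large constant depending only on ξ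
    ∀ (Efld : ℝ → E3 → E3) (EB ENB ETB CE : ℝ),
      (∀ t x, ‖Efld t x‖ ≤ EB) →
      (∀ t : ℝ, Differentiable ℝ (Efld t)) →
      (∀ t x, ‖fderiv ℝ (Efld t) x‖ ≤ ENB) →
      (∀ x : E3, Differentiable ℝ (fun τ => Efld τ x)) →
      (∀ t x, ‖deriv (fun τ => Efld τ x) t‖ ≤ ETB) →
      0 < CE →
      (∀ (t : ℝ), ∀ x ∈ frontier Ω, CE < ⟪Efld t x, nvec ξ x⟫) →
    ∃ δ₀ > 0, ∀ δw : ℝ, 0 < δw → δw < δ₀ →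
    ∀ (δ' Cδ : ℝ) (χ : ℝ → ℝ) (near : E3 → E3),
      0 < δ' → 0 < Cδ →
      -- δ' = min{|ξ(x)| : x ∈ Ω, d(x,∂Ω) = δ}
      δ' = sInf {r : ℝ | ∃ x ∈ Ω, Metric.infDist x (frontier Ω) = δw ∧ r = |ξ x|} →
      -- χ is a smooth increasing cutoff with χ(s)=s for s ≤ δ'/4, χ ≡ C_{δ'} for s ≥ δ'/2
      ContDiff ℝ (⊤ : ℕ∞) χ →
      (∀ s : ℝ, 0 ≤ s → s ≤ δ' / 4 → χ s = s) →
      (∀ s : ℝ, δ' / 2 ≤ s → χ s = Cδ) →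
      MonotoneOn χ (Set.Icc (δ' / 4) (δ' / 2)) →
      (∀ s : ℝ, deriv χ s ≤ 1) →
      -- near is the nearest-point projection on the boundary layer
      (∀ x ∈ Ω, Metric.infDist x (frontier Ω) < δw →
        near x ∈ frontier Ω ∧ dist x (near x) = Metric.infDist x (frontier Ω)) →
      -- α is continuous
      (ContinuousOn (fun q : ℝ × E3 × E3 =>
          alphaW ξ Ω Efld near χ δw Cδ q.1 q.2.1 q.2.2)
        (Set.univ ×ˢ closure Ω ×ˢ (Set.univ : Set E3))) ∧
      -- the two-sided Gronwall estimate along characteristics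
      (∀ C : ℝ, Cξ * (EB + ENB + ETB + 1) / CE ≤ C →
        ∀ (Xc Vc : ℝ → E3) (s t : ℝ), 0 ≤ s → s < t →
          (∀ τ ∈ Set.Icc s t, HasDerivAt Xc (Vc τ) τ) →
          (∀ τ ∈ Set.Icc s t, HasDerivAt Vc (Efld τ (Xc τ)) τ) →
          (∀ τ ∈ Set.Icc s t, Xc τ ∈ Ω) →
          Real.exp (-C * ∫ τ' in s..t, (‖Vc τ'‖ + 1)) *
              alphaW ξ Ω Efld near χ δw Cδ s (Xc s) (Vc s)
            ≤ alphaW ξ Ω Efld near χ δw Cδ t (Xc t) (Vc t) ∧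
          alphaW ξ Ω Efld near χ δw Cδ t (Xc t) (Vc t)
            ≤ Real.exp (C * ∫ τ' in s..t, (‖Vc τ'‖ + 1)) *
                alphaW ξ Ω Efld near χ δw Cδ s (Xc s) (Vc s)) := by
  obtain ⟨K, G, M, T, g₀, hK, hcl, G0, M0, T0, g0, hG, hM, hT, hg⟩ :=
    vl_consts ξ hξ Ω hbd hfr hgrad
  refine ⟨2 + T / Cc + (2 * G * (G + M) / g₀ + 2 * M + G + 2 * (G + M)) / g₀, by positivity, ?_⟩
  intro Efld EB ENB ETB CE hE dEx hEx dEt hEt CE0 hsgn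
  refine ⟨g₀ / (4 * M), by positivity, ?_⟩
  intro δw hδ0 hδ δ' Cδ χ near hδ'0 hCδ hδ' hχ h1 h2 h3 h4 hnear
  have hg' : ∀ p, ξ p = 0 → g₀ ≤ ‖fderiv ℝ ξ p‖ := fun p hp => hg p (by rw [hfr]; exact hp)
  have hgn : ∀ p, ‖gradient ξ p‖ = ‖fderiv ℝ ξ p‖ := fun p => by
    rw [← toDual_gradient, LinearIsometryEquiv.norm_map]
  have hin : ∀ t p, ⟪Efld t p, nvec ξ p⟫ = ‖fderiv ℝ ξ p‖⁻¹ * fderiv ℝ ξ p (Efld t p) := by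
    intro t p
    rw [nvec, inner_smul_right, inner_gradient_right, hgn]
    simp
  have data : VLData ξ Ω K G M T g₀ Cc Efld EB ENB ETB CE δw near :=
    { hξ := hξ, hΩ := hΩ, hfr := hfr, hK := hK, hcl := hcl, G0 := G0, M0 := M0, T0 := T0, g0 := g0
      Cc0 := hCc, hG := hG, hM := hM, hT := hT, hg := hg'
      hconv := fun x hx v => by
        have := hconv x hx v
        rw [iteratedFDeriv_two_apply] at this
        simpa using this
      hE := hE, dEx := dEx, hEx := hEx, dEt := dEt, hEt := hEt, CE0 := CE0
      sgn := fun t p hp => by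
        have a := hsgn t p (by rw [hfr]; exact hp)
        have b := hg' p hp
        rw [hin] at a
        have c : 0 < ‖fderiv ℝ ξ p‖ := g0.trans_le b
        rw [inv_mul_eq_div, lt_div_iff₀ c] at a
        nlinarith
      hCE := fun p hp => by
        have a := hsgn 0 p (by rw [hfr]; exact hp)
        have b := hg' p hp
        rw [hin] at a
        have c : 0 < ‖fderiv ℝ ξ p‖ := g0.trans_le b
        rw [inv_mul_eq_div, lt_div_iff₀ c] at a
        have d := (le_abs_self _).trans ((fderiv ℝ ξ p).le_opNorm (Efld 0 p))
        have e := hE 0 p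
        have f : CE * ‖fderiv ℝ ξ p‖ ≤ EB * ‖fderiv ℝ ξ p‖ := by nlinarith
        exact le_of_mul_le_mul_right f c
      δ0 := hδ0
      hδ := by
        rw [lt_div_iff₀ (by positivity)] at hδ
        linarith
      hnear := hnear }
  have dχ : Differentiable ℝ χ := hχ.differentiable (by simp)
  have hcont := data.cont_alpha hδ'0 hδ' dχ.continuous h2
  refine ⟨hcont, ?_⟩
  intro C hC X V s t _ hst hX hV hXΩ
  have hC0 : 0 ≤ C := by
    refine le_trans ?_ hC
    have := data.EB0
    have := data.ENB0
    have := data.ETB0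
    positivity
  set a : ℝ → ℝ := fun τ => alphaW ξ Ω Efld near χ δw Cδ τ (X τ) (V τ) with ha
  have apos : ∀ τ ∈ Set.Icc s t, 0 < a τ := fun τ hτ =>
    data.alpha_pos hδ'0 hCδ h1 h2 h3 (hXΩ τ hτ) τ (V τ)
  have cX : ContinuousOn X (Set.Icc s t) := fun τ hτ => (hX τ hτ).continuousAt.continuousWithinAt
  have cV : ContinuousOn V (Set.Icc s t) := fun τ hτ => (hV τ hτ).continuousAt.continuousWithinAt
  have ca : ContinuousOn a (Set.Icc s t) :=
    hcont.comp (f := fun τ => ((τ, X τ, V τ) : ℝ × E3 × E3))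
      (continuousOn_id.prodMk (cX.prodMk cV))
      (fun τ hτ => ⟨Set.mem_univ _, subset_closure (hXΩ τ hτ), Set.mem_univ _⟩)
  have cl : ContinuousOn (fun τ => Real.log (a τ)) (Set.Icc s t) :=
    ca.log (fun τ hτ => (apos τ hτ).ne')
  have key := vl_gronwall (f := fun τ => Real.log (a τ)) (W := fun τ => ‖V τ‖ + 1) (C := C) hst cl
    (cV.norm.add continuousOn_const) (fun τ hτ r hr => by
      have hτ' : τ ∈ Set.Icc s t := ⟨hτ.1, hτ.2.le⟩
      exact data.slope_alpha hδ'0 hδ' dχ h1 h2 h3 h4 (hX τ hτ') (hV τ hτ') (hXΩ τ hτ')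
        (hX τ hτ').continuousAt hC hC0 hr)
  have ps := apos s (Set.left_mem_Icc.2 hst.le)
  have pt := apos t (Set.right_mem_Icc.2 hst.le)
  rw [abs_le] at key
  set I := ∫ τ' in s..t, (‖V τ'‖ + 1) with hI
  change Real.exp (-C * I) * a s ≤ a t ∧ a t ≤ Real.exp (C * I) * a s
  have es : a s = Real.exp (Real.log (a s)) := (Real.exp_log ps).symm
  have et : a t = Real.exp (Real.log (a t)) := (Real.exp_log pt).symm
  rw [es, et, ← Real.exp_add, ← Real.exp_add, Real.exp_le_exp, Real.exp_le_exp]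
  constructor <;> linarith [key.1, key.2]

end
end

section
/- (Lemma 4.1) Suppose E satisfies the sign condition E(t,x)·n(x) > C_E > 0 for all t and all x ∈ ∂Ω. Then for any y ∈ Ω̄, 1 < β < 3, 0 < κ ≤ 1 and θ > 0 there is a constant C such that for all s and all v ∈ ℝ³: ∫_{ℝ³} e^{−θ|v−u|²} / ( |v−u|^{2−κ} α(s,y,u)^β ) du ≤ C ( ( |v|² |ξ(y)| + c(y) )^{−(β−1)/2} + 1 ), where c(y) = ξ(y)² + C_E |ξ(y)|. -/
open MeasureTheory Real
open scoped RealInnerProductSpace ENNReal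

noncomputable section

theorem aux_lintegral_prod (n : ℕ) (f : Fin n → ℝ → ℝ≥0∞) (hf : ∀ i, Measurable (f i)) :
    ∫⁻ x : Fin n → ℝ, ∏ i, f i (x i) = ∏ i, ∫⁻ t, f i t := by
  induction n with
  | zero => simp [lintegral_const, volume_pi]
  | succ n ih =>
    have h := (volume_preserving_piFinSuccAbove (fun _ : Fin (n+1) => ℝ) 0).symm
    rw [← h.lintegral_comp_emb (MeasurableEquiv.measurableEmbedding _)]
    simp only [Fin.prod_univ_succ]
    rw [← ih (fun i => f i.succ) (fun i => hf _)]
    rw [← lintegral_prod_mul (hf 0).aemeasurable]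
    · rfl
    · exact (Finset.measurable_prod _ fun i _ => (hf _).comp (measurable_pi_apply i)).aemeasurable

def K1 (θ p : ℝ) : ℝ≥0∞ :=
  ∫⁻ x : ℝ, ENNReal.ofReal (Real.exp (-θ * x ^ 2)) / ENNReal.ofReal (|x| ^ p)

theorem K1_ne_top (θ p : ℝ) (hθ : 0 < θ) (hp : p < 1) : K1 θ p ≠ ⊤ := by
  have h := integrable_rpow_mul_exp_neg_mul_sq hθ (s := -p) (by linarith)
  have h1 : IntegrableOn (fun x : ℝ => |x| ^ (-p) * Real.exp (-θ * x ^ 2)) (Set.Ioi 0) := by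
    refine h.integrableOn.congr_fun (fun x hx => ?_) measurableSet_Ioi
    simp only [abs_of_pos (Set.mem_Ioi.1 hx)]
  have h2 : IntegrableOn (fun x : ℝ => |x| ^ (-p) * Real.exp (-θ * x ^ 2)) (Set.Iio 0) := by
    have := h1.comp_neg
    simpa using this
  have h3 : Integrable (fun x : ℝ => |x| ^ (-p) * Real.exp (-θ * x ^ 2)) := by
    rw [← integrableOn_univ, ← Set.Iic_union_Ioi (a := (0:ℝ)), integrableOn_union,
      integrableOn_Iic_iff_integrableOn_Iio]
    exact ⟨h2, h1⟩
  have h4 := h3.lintegral_lt_top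
  refine ne_of_lt (lt_of_le_of_lt (le_of_eq ?_) h4)
  unfold K1
  apply lintegral_congr_ae
  have : ∀ᵐ x : ℝ, x ≠ 0 := by simp [ae_iff]
  filter_upwards [this] with x hx
  have hx' : 0 < |x| := abs_pos.2 hx
  rw [← ENNReal.ofReal_div_of_pos (by positivity), Real.rpow_neg hx'.le]
  congr 1
  field_simp

theorem aux_point (θ a : ℝ) (ha : 0 < a) (x y z r : ℝ) (hr : 0 ≤ r)
    (h : r ^ 2 = x ^ 2 + y ^ 2 + z ^ 2) :
    ENNReal.ofReal (Real.exp (-θ * r ^ 2)) / ENNReal.ofReal (r ^ a) ≤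
      ENNReal.ofReal (Real.exp (-θ * x ^ 2)) *
      ((ENNReal.ofReal (Real.exp (-θ * y ^ 2)) / ENNReal.ofReal (|y| ^ (a / 2))) *
      (ENNReal.ofReal (Real.exp (-θ * z ^ 2)) / ENNReal.ofReal (|z| ^ (a / 2)))) := by
  have e1 : ENNReal.ofReal (Real.exp (-θ * r ^ 2)) = ENNReal.ofReal (Real.exp (-θ * x ^ 2)) *
      (ENNReal.ofReal (Real.exp (-θ * y ^ 2)) * ENNReal.ofReal (Real.exp (-θ * z ^ 2))) := by
    rw [← ENNReal.ofReal_mul (by positivity), ← ENNReal.ofReal_mul (by positivity),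
      ← Real.exp_add, ← Real.exp_add, h]
    congr 2; ring
  have e2 : |y| ^ (a/2) * |z| ^ (a/2) ≤ r ^ a := by
    rw [← Real.mul_rpow (abs_nonneg _) (abs_nonneg _)]
    have : r ^ a = (r ^ 2) ^ (a / 2) := by
      rw [← Real.rpow_natCast, ← Real.rpow_mul hr]; congr 1; push_cast; ring
    rw [this]
    apply Real.rpow_le_rpow (by positivity) _ (by positivity)
    rw [h, ← sq_abs y, ← sq_abs z]
    nlinarith [sq_nonneg (|y| - |z|), sq_nonneg x, sq_nonneg (|y| + |z|)]
  have e3 : (ENNReal.ofReal (r ^ a))⁻¹ ≤ (ENNReal.ofReal (|y| ^ (a / 2)))⁻¹ *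
      (ENNReal.ofReal (|z| ^ (a / 2)))⁻¹ := by
    rw [← ENNReal.mul_inv (by simp) (by simp), ← ENNReal.ofReal_mul (by positivity)]
    exact ENNReal.inv_le_inv.2 (ENNReal.ofReal_le_ofReal e2)
  rw [div_eq_mul_inv, e1, div_eq_mul_inv (ENNReal.ofReal (Real.exp (-θ * y ^ 2))),
    div_eq_mul_inv (ENNReal.ofReal (Real.exp (-θ * z ^ 2)))]
  calc _ ≤ _ := mul_le_mul_right e3 _
    _ = _ := by ring

theorem aux_basis (g : E3) (hg : g ≠ 0) : ∃ b : OrthonormalBasis (Fin 3) ℝ E3,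
    ∀ w : E3, ⟪w, g⟫ = ‖g‖ * b.repr w 0 := by
  have hn : ‖g‖ ≠ 0 := norm_ne_zero_iff.2 hg
  obtain ⟨b, hb⟩ := Orthonormal.exists_orthonormalBasis_extension_of_card_eq (𝕜 := ℝ) (E := E3)
    (ι := Fin 3) (by simp) (v := fun _ => ‖g‖⁻¹ • g) (s := {0}) (by
      constructor
      · intro i; simp [norm_smul, hn]
      · intro i j hij; exact absurd (Subsingleton.elim i j) hij)
  refine ⟨b, fun w => ?_⟩
  rw [b.repr_apply_apply, hb 0 (by simp), real_inner_smul_left, real_inner_comm]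
  field_simp

theorem aux_int (θ a : ℝ) (ha : 0 < a) (b : OrthonormalBasis (Fin 3) ℝ E3)
    (f : ℝ → ℝ≥0∞) (hf : Measurable f) :
    ∫⁻ w : E3, ENNReal.ofReal (Real.exp (-θ * ‖w‖ ^ 2)) / ENNReal.ofReal (‖w‖ ^ a)
        * f (b.repr w 0)
      ≤ (∫⁻ x, ENNReal.ofReal (Real.exp (-θ * x ^ 2)) * f x) * (K1 θ (a/2) * K1 θ (a/2)) := by
  set G : ℝ → ℝ≥0∞ := fun x =>
    ENNReal.ofReal (Real.exp (-θ * x ^ 2)) / ENNReal.ofReal (|x| ^ (a/2)) with hG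
  have hGm : Measurable G := by
    apply Measurable.div <;> fun_prop
  set F : Fin 3 → ℝ → ℝ≥0∞ :=
    ![fun x => ENNReal.ofReal (Real.exp (-θ * x ^ 2)) * f x, G, G] with hF
  have hFm : ∀ i, Measurable (F i) := by
    intro i
    fin_cases i
    · simp only [hF]; exact Measurable.mul (by fun_prop) hf
    · exact hGm
    · exact hGm
  calc _ ≤ ∫⁻ w : E3, ∏ i, F i (b.repr w i) := by
        apply lintegral_mono
        intro w
        have hn : ‖w‖ ^ 2 = (b.repr w 0)^2 + (b.repr w 1)^2 + (b.repr w 2)^2 := by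
          rw [← b.repr.norm_map w, EuclideanSpace.norm_sq_eq, Fin.sum_univ_three]
          simp
        have := aux_point θ a ha _ _ _ _ (norm_nonneg w) hn
        simp only [Fin.prod_univ_three]
        calc _ ≤ _ := mul_le_mul_left this _
          _ = F 0 (b.repr w 0) * F 1 (b.repr w 1) * F 2 (b.repr w 2) := by
            change _ = (ENNReal.ofReal (Real.exp (-θ * (b.repr w 0) ^ 2)) * f (b.repr w 0)) *
              G (b.repr w 1) * G (b.repr w 2)
            simp only [hG]
            generalize ENNReal.ofReal (Real.exp (-θ * (b.repr w 1) ^ 2)) / _ = p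
            generalize ENNReal.ofReal (Real.exp (-θ * (b.repr w 2) ^ 2)) / _ = q
            ring
    _ = ∫⁻ x : Fin 3 → ℝ, ∏ i, F i (x i) := by
        have := (EuclideanSpace.volume_preserving_symm_measurableEquiv_toLp (Fin 3)).comp
          b.measurePreserving_repr
        rw [← this.lintegral_comp]
        · rfl
        · exact Finset.measurable_prod _ fun i _ => (hFm _).comp (measurable_pi_apply i)
    _ = _ := by
        rw [aux_lintegral_prod 3 F hFm, Fin.prod_univ_three]
        change (∫⁻ x, ENNReal.ofReal (Real.exp (-θ * x ^ 2)) * f x) * K1 θ (a/2) * K1 θ (a/2) = _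
        rw [mul_assoc]

def K2 (β : ℝ) : ℝ≥0∞ := ∫⁻ x : ℝ, ENNReal.ofReal ((1 + ‖x‖^2) ^ (-β/2))

theorem K2_ne_top (β : ℝ) (hβ : 1 < β) : K2 β ≠ ⊤ := by
  have := integrable_rpow_neg_one_add_norm_sq (E := ℝ) (μ := volume) (r := β) (by simpa using hβ)
  exact this.lintegral_lt_top.ne

theorem aux_scale (β A τ : ℝ) (hβ : 1 < β) (hA : 0 < A) :
    ∫⁻ x : ℝ, ENNReal.ofReal (((τ - x) ^ 2 + A) ^ (-β/2)) =
      K2 β * (ENNReal.ofReal A ^ ((β - 1) / 2))⁻¹ := by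
  have h0 := lintegral_sub_left_eq_self (μ := (volume : Measure ℝ))
    (fun x => ENNReal.ofReal ((x ^ 2 + A) ^ (-β/2))) τ
  rw [h0]
  have hi := integrable_rpow_neg_one_add_norm_sq (E := ℝ) (μ := volume) (r := β)
    (by simpa using hβ)
  have hs : 0 < (√A)⁻¹ := by positivity
  have hpt : ∀ x : ℝ, (x ^ 2 + A) ^ (-β/2) =
      A ^ (-β/2) * (1 + ‖(√A)⁻¹ * x‖ ^ 2) ^ (-β/2) := by
    intro x
    rw [← Real.mul_rpow hA.le (by positivity)]
    congr 1
    rw [Real.norm_eq_abs, sq_abs, mul_pow, inv_pow, Real.sq_sqrt hA.le]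
    field_simp; ring
  simp only [hpt]
  rw [← ofReal_integral_eq_lintegral_ofReal ((hi.comp_mul_left' hs.ne').const_mul _)
    (Filter.Eventually.of_forall fun x => by positivity)]
  rw [integral_const_mul, Measure.integral_comp_mul_left (fun x : ℝ => (1 + ‖x‖ ^ 2) ^ (-β/2)),
    K2, ← ofReal_integral_eq_lintegral_ofReal hi (Filter.Eventually.of_forall fun x => by positivity),
    ENNReal.ofReal_rpow_of_pos hA, ← ENNReal.ofReal_inv_of_pos (by positivity),
    ← ENNReal.ofReal_mul (by positivity)]
  congr 1
  rw [inv_inv, abs_of_pos (by positivity), ← Real.rpow_neg hA.le, smul_eq_mul, ← mul_assoc,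
    mul_comm]
  congr 1
  rw [Real.sqrt_eq_rpow, ← Real.rpow_add hA]
  congr 1; ring

theorem aux_exp (θ β s : ℝ) (hθ : 0 < θ) (hβ : 0 < β) (hs : 0 ≤ s) :
    Real.exp (-θ * s) * (1 + s) ^ (β/2) ≤
      (1 + β/θ) ^ (β/2) * Real.exp (-(θ/2) * s) := by
  have h1 : 1 + s ≤ (1 + β/θ) * Real.exp (θ/β * s) := by
    have := Real.add_one_le_exp (θ/β * s)
    have h2 : (1 + β/θ) * (θ/β * s + 1) ≤ (1 + β/θ) * Real.exp (θ/β * s) := by gcongr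
    have h3 : (1 + β/θ) * (θ/β * s + 1) = 1 + s + (θ/β * s + β/θ) := by field_simp; ring
    have : 0 ≤ θ/β * s + β/θ := by positivity
    linarith
  have h4 : (1 + s) ^ (β/2) ≤ (1 + β/θ) ^ (β/2) * Real.exp (θ/2 * s) := by
    calc _ ≤ _ := Real.rpow_le_rpow (by positivity) h1 (by positivity)
      _ = _ := by
        rw [Real.mul_rpow (by positivity) (by positivity), ← Real.exp_mul]
        congr 2; field_simp
  calc _ ≤ Real.exp (-θ * s) * ((1 + β/θ) ^ (β/2) * Real.exp (θ/2 * s)) := by gcongr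
    _ = (1 + β/θ) ^ (β/2) * (Real.exp (-θ * s) * Real.exp (θ/2 * s)) := by ring
    _ = _ := by rw [← Real.exp_add]; congr 2; ring

def QQ (θ a : ℝ) (w : E3) : ℝ≥0∞ :=
  ENNReal.ofReal (Real.exp (-θ * ‖w‖ ^ 2)) / ENNReal.ofReal (‖w‖ ^ a)

theorem QQ_meas (θ a : ℝ) : Measurable (QQ θ a) := by
  apply Measurable.div <;> fun_prop

def K0 (θ a : ℝ) : ℝ≥0∞ := ∫⁻ w, QQ θ a w

theorem K0_ne_top (θ a : ℝ) (hθ : 0 < θ) (ha : 0 < a) (ha2 : a < 2) : K0 θ a ≠ ⊤ := by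
  have h := aux_int θ a ha (EuclideanSpace.basisFun (Fin 3) ℝ) (fun _ => 1) measurable_const
  simp only [mul_one] at h
  refine ne_top_of_le_ne_top ?_ h
  have h1 := K1_ne_top θ (a/2) hθ (by linarith)
  exact ENNReal.mul_ne_top (integrable_exp_neg_mul_sq hθ).lintegral_lt_top.ne
    (ENNReal.mul_ne_top h1 h1)

theorem aux_split (θ a β r al : ℝ) (hr : 0 ≤ r) :
    ENNReal.ofReal (Real.exp (-θ * r ^ 2)) / ENNReal.ofReal (r ^ a * al ^ β) =
    ENNReal.ofReal (Real.exp (-θ * r ^ 2)) / ENNReal.ofReal (r ^ a) *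
      (ENNReal.ofReal (al ^ β))⁻¹ := by
  rw [ENNReal.ofReal_mul (by positivity), div_eq_mul_inv, div_eq_mul_inv,
    ENNReal.mul_inv (by simp) (by simp), mul_assoc]

theorem aux_inv (m al β : ℝ) (hβ : 0 < β) (hm : 0 < m) (h : m ≤ al) :
    (ENNReal.ofReal (al ^ β))⁻¹ ≤ ENNReal.ofReal (m ^ (-β)) := by
  rw [Real.rpow_neg hm.le, ENNReal.ofReal_inv_of_pos (by positivity)]
  exact ENNReal.inv_le_inv.2 (ENNReal.ofReal_le_ofReal (Real.rpow_le_rpow hm.le h hβ.le))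

theorem aux_const (θ a β m : ℝ) (hβ : 0 < β) (hm : 0 < m) (v : E3) (al : E3 → ℝ)
    (h : ∀ u, m ≤ al u) :
    ∫⁻ u : E3, ENNReal.ofReal (Real.exp (-θ * ‖v - u‖ ^ 2))
            / ENNReal.ofReal (‖v - u‖ ^ a * al u ^ β) ≤ K0 θ a * ENNReal.ofReal (m ^ (-β)) := by
  calc _ ≤ ∫⁻ u : E3, (fun w => QQ θ a w * ENNReal.ofReal (m ^ (-β))) (v - u) := by
        apply lintegral_mono
        intro u
        simp only []
        rw [aux_split _ _ _ _ _ (norm_nonneg _)]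
        exact mul_le_mul_right (aux_inv m _ β hβ hm (h u)) _
    _ = ∫⁻ w, QQ θ a w * ENNReal.ofReal (m ^ (-β)) :=
        lintegral_sub_left_eq_self (μ := (volume : Measure E3))
          (fun w => QQ θ a w * ENNReal.ofReal (m ^ (-β))) v
    _ = _ := by rw [lintegral_mul_const _ (QQ_meas θ a)]; rfl

theorem aux_quad (c c0 CE X : ℝ) (hc : 0 < c) (hc0 : 0 < c0) (hCE : 0 < CE) (hX : 0 < X)
    (ng x0 n2 v2 u2 : ℝ) (hng : c0 ≤ ng) (hn2 : 0 ≤ n2) (hu2 : 0 ≤ u2)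
    (hv : v2 ≤ 2 * u2 + 2 * n2) :
    min (c0 ^ 2) (c / (2 + 2 / CE)) * (x0 ^ 2 + (v2 * X + (X ^ 2 + CE * X))) / (1 + n2) ≤
      (ng * x0) ^ 2 + c * (X ^ 2 + (u2 + CE) * X) := by
  set k := min (c0 ^ 2) (c / (2 + 2 / CE)) with hk
  have hk0 : 0 < k := by rw [hk]; positivity
  have hk1 : k ≤ c0 ^ 2 := min_le_left _ _
  have hk2 : k * (2 + 2 / CE) ≤ c := by
    rw [← le_div_iff₀ (by positivity)]; exact min_le_right _ _
  rw [div_le_iff₀ (by positivity)]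
  have h1 : k * x0 ^ 2 ≤ (ng * x0) ^ 2 * (1 + n2) := by
    have : k ≤ ng ^ 2 := hk1.trans (by gcongr)
    calc k * x0 ^ 2 ≤ ng ^ 2 * x0 ^ 2 := by gcongr
      _ = (ng * x0) ^ 2 * 1 := by ring
      _ ≤ _ := by gcongr; linarith
  have h2 : v2 + CE ≤ (2 + 2 / CE) * (1 + n2) * (u2 + CE) := by
    have e : (2 + 2 / CE) * (1 + n2) * (u2 + CE) =
      2 * u2 + 2 * CE + 2 * n2 + 2 + 2 * n2 * u2 + 2 * n2 * CE +
        2 / CE * u2 * (1 + n2) := by field_simp; ring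
    have : 0 ≤ 2 / CE * u2 * (1 + n2) := by positivity
    have : 0 ≤ 2 * n2 * u2 + 2 * n2 * CE := by positivity
    rw [e]; linarith
  have h3 : X ^ 2 ≤ (2 + 2 / CE) * (1 + n2) * X ^ 2 := by
    have : 1 ≤ (2 + 2 / CE) * (1 + n2) := by
      have : 0 < 2 / CE := by positivity
      nlinarith [mul_nonneg this.le hn2]
    nlinarith [sq_nonneg X]
  have h4 : v2 * X + (X ^ 2 + CE * X) ≤ (2 + 2 / CE) * (1 + n2) * (X ^ 2 + (u2 + CE) * X) := by
    nlinarith [mul_le_mul_of_nonneg_right h2 hX.le]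
  have h5 : k * (v2 * X + (X ^ 2 + CE * X)) ≤ c * (X ^ 2 + (u2 + CE) * X) * (1 + n2) := by
    calc _ ≤ k * ((2 + 2 / CE) * (1 + n2) * (X ^ 2 + (u2 + CE) * X)) := by gcongr
      _ = (k * (2 + 2 / CE)) * ((1 + n2) * (X ^ 2 + (u2 + CE) * X)) := by ring
      _ ≤ c * ((1 + n2) * (X ^ 2 + (u2 + CE) * X)) := by gcongr
      _ = _ := by ring
  linarith

theorem aux_main (θ a β m c c0 CE k : ℝ) (hθ : 0 < θ) (ha : 0 < a) (hβ : 1 < β) (hm : 0 < m)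
    (hc : 0 < c) (hc0 : 0 < c0) (hCE : 0 < CE) (hk : k = min (c0 ^ 2) (c / (2 + 2 / CE)))
    (X : ℝ) (hX : 0 < X) (g : E3) (hg : c0 ≤ ‖g‖)
    (v : E3) (al S : E3 → ℝ)
    (hS : ∀ u, ⟪u, g⟫ ^ 2 + c * (X ^ 2 + (‖u‖ ^ 2 + CE) * X) ≤ S u)
    (h : ∀ u, min (√(S u)) m ≤ al u) :
    ∫⁻ u : E3, ENNReal.ofReal (Real.exp (-θ * ‖v - u‖ ^ 2))
            / ENNReal.ofReal (‖v - u‖ ^ a * al u ^ β) ≤ K0 θ a * ENNReal.ofReal (m ^ (-β)) +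
      (ENNReal.ofReal (k ^ (-β/2) * (1 + β/θ) ^ (β/2)) * K2 β * (K1 (θ/2) (a/2) * K1 (θ/2) (a/2)))
      * (ENNReal.ofReal (‖v‖ ^ 2 * X + (X ^ 2 + CE * X)) ^ ((β - 1) / 2))⁻¹ := by
  have hg0 : g ≠ 0 := by
    rintro rfl
    simp at hg; linarith
  obtain ⟨b, hb⟩ := aux_basis g hg0
  set A := ‖v‖ ^ 2 * X + (X ^ 2 + CE * X) with hA
  have hA0 : 0 < A := by positivity
  have hk0 : 0 < k := by rw [hk]; positivity
  set τ := b.repr v 0 with hτ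
  set M := ENNReal.ofReal (k ^ (-β/2) * (1 + β/θ) ^ (β/2)) with hM
  set f : ℝ → ℝ≥0∞ := fun x => ENNReal.ofReal (((τ - x) ^ 2 + A) ^ (-β/2)) with hf
  have hfm : Measurable f := by fun_prop
  have hrm : Measurable (fun w : E3 => b.repr w 0) := by
    simp only [b.repr_apply_apply]; fun_prop
  have hpt : ∀ w : E3, QQ θ a w * (ENNReal.ofReal (al (v - w) ^ β))⁻¹ ≤
      QQ θ a w * ENNReal.ofReal (m ^ (-β)) + M * (QQ (θ/2) a w * f (b.repr w 0)) := by
    intro w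
    by_cases hcase : m ≤ al (v - w)
    · exact le_add_right (mul_le_mul_right (aux_inv m _ β (by linarith) hm hcase) _)
    · refine le_trans ?_ le_add_self
      have h1 : √(S (v - w)) ≤ al (v - w) := by
        rcases min_le_iff.1 (h (v - w)) with h' | h'
        · exact h'
        · exact absurd h' hcase
      set D := (τ - b.repr w 0) ^ 2 + A with hD
      have hD0 : 0 < D := by positivity
      have h2 : k * D / (1 + ‖w‖ ^ 2) ≤ S (v - w) := by
        refine le_trans ?_ (hS (v - w))
        have e : ⟪v - w, g⟫ = ‖g‖ * (τ - b.repr w 0) := by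
          rw [hb]; simp [hτ]
        rw [e, hk]
        apply aux_quad c c0 CE X hc hc0 hCE hX _ _ _ _ _ hg (by positivity) (by positivity)
        have h3 : ‖v‖ ≤ ‖v - w‖ + ‖w‖ := by
          simpa using norm_add_le (v - w) w
        nlinarith [sq_nonneg (‖v - w‖ - ‖w‖), norm_nonneg v, norm_nonneg w, norm_nonneg (v - w)]
      have hp : 0 < k * D / (1 + ‖w‖ ^ 2) := by positivity
      have h3 := aux_inv (√(k * D / (1 + ‖w‖ ^ 2))) (al (v - w)) β (by linarith)
        (by positivity) (le_trans (Real.sqrt_le_sqrt h2) h1)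
      have e4 : √(k * D / (1 + ‖w‖ ^ 2)) ^ (-β) =
          (1 + ‖w‖ ^ 2) ^ (β/2) * (k ^ (-β/2) * D ^ (-β/2)) := by
        rw [Real.sqrt_eq_rpow, ← Real.rpow_mul hp.le,
          show (1/2 : ℝ) * (-β) = -β/2 by ring, Real.div_rpow (by positivity) (by positivity),
          Real.mul_rpow hk0.le hD0.le, neg_div, Real.rpow_neg (x := 1 + ‖w‖^2) (by positivity)]
        field_simp
      rw [e4] at h3
      refine le_trans (mul_le_mul_right h3 _) ?_
      simp only [QQ, hf, hM]
      rw [← hD, div_eq_mul_inv, div_eq_mul_inv (ENNReal.ofReal (Real.exp (-(θ/2) * ‖w‖ ^ 2)))]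
      have h5 := aux_exp θ β (‖w‖ ^ 2) hθ (by linarith) (by positivity)
      have h6 : ENNReal.ofReal (Real.exp (-θ * ‖w‖ ^ 2)) *
          ENNReal.ofReal ((1 + ‖w‖ ^ 2) ^ (β/2) * (k ^ (-β/2) * D ^ (-β/2))) ≤
          ENNReal.ofReal (k ^ (-β/2) * (1 + β/θ) ^ (β/2)) *
          (ENNReal.ofReal (Real.exp (-(θ/2) * ‖w‖ ^ 2)) * ENNReal.ofReal (D ^ (-β/2))) := by
        have : 0 < β / θ := by apply div_pos <;> linarith
        rw [← ENNReal.ofReal_mul (by positivity), ← ENNReal.ofReal_mul (by positivity),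
          ← ENNReal.ofReal_mul (by positivity)]
        apply ENNReal.ofReal_le_ofReal
        calc _ = (Real.exp (-θ * ‖w‖ ^ 2) * (1 + ‖w‖ ^ 2) ^ (β/2)) *
                (k ^ (-β/2) * D ^ (-β/2)) := by ring
          _ ≤ ((1 + β/θ) ^ (β/2) * Real.exp (-(θ/2) * ‖w‖ ^ 2)) *
                (k ^ (-β/2) * D ^ (-β/2)) := by gcongr
          _ = _ := by ring
      calc _ = (ENNReal.ofReal (Real.exp (-θ * ‖w‖ ^ 2)) *
          ENNReal.ofReal ((1 + ‖w‖ ^ 2) ^ (β/2) * (k ^ (-β/2) * D ^ (-β/2)))) *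
            (ENNReal.ofReal (‖w‖ ^ a))⁻¹ := by ring
        _ ≤ _ := mul_le_mul_left h6 _
        _ = _ := by ring
  calc _ = ∫⁻ u : E3, (fun w => QQ θ a w * (ENNReal.ofReal (al (v - w) ^ β))⁻¹) (v - u) := by
        congr 1; ext u
        simp only [sub_sub_cancel]
        rw [aux_split _ _ _ _ _ (norm_nonneg _)]; rfl
    _ = ∫⁻ w, QQ θ a w * (ENNReal.ofReal (al (v - w) ^ β))⁻¹ :=
        lintegral_sub_left_eq_self (μ := (volume : Measure E3))
          (fun w => QQ θ a w * (ENNReal.ofReal (al (v - w) ^ β))⁻¹) v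
    _ ≤ ∫⁻ w, (QQ θ a w * ENNReal.ofReal (m ^ (-β)) + M * (QQ (θ/2) a w * f (b.repr w 0))) :=
        lintegral_mono hpt
    _ = K0 θ a * ENNReal.ofReal (m ^ (-β)) + M * ∫⁻ w, QQ (θ/2) a w * f (b.repr w 0) := by
        rw [lintegral_add_left ((QQ_meas θ a).mul_const _), lintegral_mul_const _ (QQ_meas θ a),
          lintegral_const_mul M (f := fun w => QQ (θ/2) a w * f (b.repr w 0))
            ((QQ_meas _ _).mul (hfm.comp hrm))]
        rfl
    _ ≤ _ := by
        refine add_le_add le_rfl ?_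
        have h7 := aux_int (θ/2) a ha b f hfm
        have h8 : ∫⁻ x, ENNReal.ofReal (Real.exp (-(θ/2) * x ^ 2)) * f x ≤ ∫⁻ x, f x := by
          apply lintegral_mono
          intro x
          simp only []
          refine le_trans (mul_le_mul_left (b := ENNReal.ofReal (Real.exp (-(θ/2) * x ^ 2)))
            (c := 1) ?_ (f x)) (by simp)
          rw [← ENNReal.ofReal_one]
          apply ENNReal.ofReal_le_ofReal
          rw [Real.exp_le_one_iff]
          nlinarith [sq_nonneg x]
        have h9 := aux_scale β A τ hβ hA0
        calc M * ∫⁻ w, QQ (θ/2) a w * f (b.repr w 0)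
            ≤ M * ((∫⁻ x, ENNReal.ofReal (Real.exp (-(θ/2) * x ^ 2)) * f x) *
              (K1 (θ/2) (a/2) * K1 (θ/2) (a/2))) := mul_le_mul_right h7 _
          _ ≤ M * ((K2 β * (ENNReal.ofReal A ^ ((β - 1) / 2))⁻¹) *
              (K1 (θ/2) (a/2) * K1 (θ/2) (a/2))) := by
                rw [← h9]; exact mul_le_mul_right (mul_le_mul_left h8 _) _
          _ = _ := by ring

theorem aux_chi (χ : ℝ → ℝ) (δ' Cδ : ℝ) (hδ' : 0 < δ')
    (hχid : ∀ s : ℝ, 0 ≤ s → s ≤ δ' / 4 → χ s = s)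
    (hχc : ∀ s : ℝ, δ' / 2 ≤ s → χ s = Cδ)
    (hχmono : MonotoneOn χ (Set.Icc (δ' / 4) (δ' / 2))) (s : ℝ) (hs : 0 ≤ s) :
    min s (δ' / 4) ≤ χ s := by
  have h4 : χ (δ' / 4) = δ' / 4 := hχid _ (by positivity) le_rfl
  rcases le_total s (δ' / 4) with h | h
  · rw [hχid s hs h]; exact min_le_left _ _
  · refine (min_le_right _ _).trans ?_
    rcases le_total s (δ' / 2) with h' | h'
    · rw [← h4]
      exact (le_of_eq (by rw [h4])).trans
        (hχmono ⟨le_rfl, by linarith⟩ ⟨h, h'⟩ h)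
    · rw [hχc s h', ← hχc (δ' / 2) le_rfl]
      have := hχmono (a := δ' / 4) (b := δ' / 2) ⟨le_rfl, by linarith⟩ ⟨by linarith, le_rfl⟩
        (by linarith)
      linarith

theorem aux_grad (ξ : E3 → ℝ) (hξ : ContDiff ℝ 3 ξ) (Ω : Set E3)
    (hbd : Bornology.IsBounded Ω) (ε : ℝ) (hε : 0 < ε)
    (hg : ∀ x : E3, |ξ x| < ε → gradient ξ x ≠ 0) :
    ∃ c0 > 0, ∀ x ∈ closure Ω, |ξ x| ≤ ε / 2 → c0 ≤ ‖gradient ξ x‖ := by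
  have hc : Continuous (fun x => ‖gradient ξ x‖) := by
    have h1 : Continuous (fderiv ℝ ξ) := hξ.continuous_fderiv (by norm_num)
    unfold gradient
    fun_prop
  have hK : IsCompact (closure Ω ∩ {x | |ξ x| ≤ ε / 2}) :=
    hbd.isCompact_closure.inter_right (isClosed_le (hξ.continuous.abs) continuous_const)
  rcases (closure Ω ∩ {x | |ξ x| ≤ ε / 2}).eq_empty_or_nonempty with h | h
  · refine ⟨1, one_pos, fun x hx hx' => ?_⟩
    have : x ∈ closure Ω ∩ {x | |ξ x| ≤ ε / 2} := ⟨hx, hx'⟩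
    rw [h] at this
    exact this.elim
  · obtain ⟨z, hz, hmin⟩ := hK.exists_isMinOn h hc.continuousOn
    refine ⟨‖gradient ξ z‖, norm_pos_iff.2 (hg z ?_), fun x hx hx' => hmin ⟨hx, hx'⟩⟩
    have : |ξ z| ≤ ε / 2 := hz.2
    linarith

/-- **Lemma 4.1.** Under the sign condition `E·n > C_E > 0` on `∂Ω`, for `1 < β < 3`,
`0 < κ ≤ 1`, `θ > 0`, there is `C` such that for every `y ∈ Ω̄`, every time `s`, and all `v`:
`∫_{ℝ³} e^{−θ|v−u|²} / (|v−u|^{2−κ} α(s,y,u)^β) du ≤ C ((|v|²|ξ(y)| + c(y))^{−(β−1)/2} + 1)`,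
where `c(y) = ξ(y)² + C_E |ξ(y)|`. -/
theorem lemma_4_1_velocity_integral_of_inverse_alpha
    (ξ : E3 → ℝ) (hξ : ContDiff ℝ 3 ξ)
    (Ω : Set E3) (hΩ : Ω = {x | ξ x < 0}) (hbd : Bornology.IsBounded Ω)
    (hfr : frontier Ω = {x | ξ x = 0})
    (Cc : ℝ) (hCc : 0 < Cc)
    (hconv : ∀ x ∈ closure Ω, ∀ ζ : E3, Cc * ‖ζ‖ ^ 2 ≤ iteratedFDeriv ℝ 2 ξ x ![ζ, ζ])
    (hgrad : ∃ ε > 0, ∀ x : E3, |ξ x| < ε → gradient ξ x ≠ 0)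
    (Efld : ℝ → E3 → E3) (EB : ℝ) (hEB : ∀ t x, ‖Efld t x‖ ≤ EB)
    (CE : ℝ) (hCE : 0 < CE)
    (hsign : ∀ (t : ℝ), ∀ x ∈ frontier Ω, CE < ⟪Efld t x, nvec ξ x⟫)
    (δw δ' Cδ : ℝ) (hδw : 0 < δw) (hδ' : 0 < δ') (hCδ : 0 < Cδ)
    (χ : ℝ → ℝ) (near : E3 → E3)
    (hχsm : ContDiff ℝ (⊤ : ℕ∞) χ)
    (hχid : ∀ s : ℝ, 0 ≤ s → s ≤ δ' / 4 → χ s = s)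
    (hχc : ∀ s : ℝ, δ' / 2 ≤ s → χ s = Cδ)
    (hχmono : MonotoneOn χ (Set.Icc (δ' / 4) (δ' / 2)))
    (hχd : ∀ s : ℝ, deriv χ s ≤ 1)
    (hnear : ∀ x ∈ Ω, Metric.infDist x (frontier Ω) < δw →
      near x ∈ frontier Ω ∧ dist x (near x) = Metric.infDist x (frontier Ω))
    (βe : ℝ) (hβ1 : 1 < βe) (hβ3 : βe < 3)
    (κ : ℝ) (hκ0 : 0 < κ) (hκ1 : κ ≤ 1)
    (θ : ℝ) (hθ : 0 < θ) :
    ∃ C : ℝ≥0∞, C ≠ ⊤ ∧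
      ∀ y ∈ closure Ω, ∀ (s : ℝ) (v : E3),
        (∫⁻ u : E3,
          ENNReal.ofReal (Real.exp (-θ * ‖v - u‖ ^ 2))
            / ENNReal.ofReal (‖v - u‖ ^ (2 - κ)
                * alphaW ξ Ω Efld near χ δw Cδ s y u ^ βe))
        ≤ C * (ENNReal.ofReal
              (‖v‖ ^ 2 * |ξ y| + (ξ y ^ 2 + CE * |ξ y|)) ^ ((βe - 1) / 2))⁻¹
          + C := by
  obtain ⟨ε, hε, hg⟩ := hgrad
  obtain ⟨c0, hc0, hgr⟩ := aux_grad ξ hξ Ω hbd ε hε hg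
  set c := min 1 (min (2 * Cc) (2 * c0)) with hc
  have hcpos : 0 < c := by positivity
  set m := min (min (δ' / 4) Cδ) (ε / 2) with hm
  have hmpos : 0 < m := by positivity
  have hm1 : m ≤ δ' / 4 := (min_le_left _ _).trans (min_le_left _ _)
  have hm2 : m ≤ Cδ := (min_le_left _ _).trans (min_le_right _ _)
  have hm3 : m ≤ ε / 2 := min_le_right _ _
  set k := min (c0 ^ 2) (c / (2 + 2 / CE)) with hk
  set P1 := K0 θ (2 - κ) * ENNReal.ofReal (m ^ (-βe)) with hP1
  set P2 := ENNReal.ofReal (k ^ (-βe/2) * (1 + βe/θ) ^ (βe/2)) * K2 βe *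
    (K1 (θ/2) ((2 - κ)/2) * K1 (θ/2) ((2 - κ)/2)) with hP2
  have hK1 := K1_ne_top (θ/2) ((2 - κ)/2) (by linarith) (by linarith)
  have hP1t : P1 ≠ ⊤ := ENNReal.mul_ne_top
    (K0_ne_top θ (2 - κ) hθ (by linarith) (by linarith)) ENNReal.ofReal_ne_top
  have hP2t : P2 ≠ ⊤ := ENNReal.mul_ne_top (ENNReal.mul_ne_top ENNReal.ofReal_ne_top
    (K2_ne_top βe hβ1)) (ENNReal.mul_ne_top hK1 hK1)
  refine ⟨P1 + P2 + 1, by simp [hP1t, hP2t], ?_⟩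
  have hP1le : P1 ≤ P1 + P2 + 1 := by rw [add_assoc]; exact le_self_add
  have hP2le : P2 ≤ P1 + P2 + 1 := le_trans le_add_self le_self_add
  intro y hy s v
  by_cases hy0 : ξ y = 0
  · have : (ENNReal.ofReal (‖v‖ ^ 2 * |ξ y| + (ξ y ^ 2 + CE * |ξ y|)) ^ ((βe - 1) / 2))⁻¹
        = ⊤ := by
      rw [hy0]
      have : 0 < (βe - 1) / 2 := by linarith
      simp [ENNReal.zero_rpow_of_pos this]
    rw [this, ENNReal.mul_top (by simp)]
    simp
  have hyΩ : y ∈ Ω := by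
    rw [closure_eq_self_union_frontier, hfr] at hy
    exact hy.resolve_right hy0
  have hyneg : ξ y < 0 := by rw [hΩ] at hyΩ; exact hyΩ
  set X := |ξ y| with hX
  have hXe : ξ y = -X := by rw [hX, abs_of_neg hyneg, neg_neg]
  have hXpos : 0 < X := abs_pos.2 hy0
  by_cases hd : Metric.infDist y (frontier Ω) < δw
  swap
  · refine le_trans ?_ (hP1le.trans le_add_self)
    apply aux_const θ (2 - κ) βe m (by linarith) hmpos v
    intro u
    rw [alphaW, if_neg hd]
    exact hm2
  obtain ⟨hn, -⟩ := hnear y hyΩ hd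
  have hEn : CE * c0 ≤ ⟪Efld s (near y), gradient ξ (near y)⟫ := by
    have h1 := hsign s (near y) hn
    have h2 : ξ (near y) = 0 := by rw [hfr] at hn; exact hn
    have h3 := hgr (near y) (frontier_subset_closure hn) (by rw [h2, abs_zero]; positivity)
    rw [nvec, real_inner_smul_right] at h1
    have h4 : 0 < ‖gradient ξ (near y)‖ := lt_of_lt_of_le hc0 h3
    rw [inv_mul_eq_div, lt_div_iff₀ h4] at h1
    nlinarith
  set S : E3 → ℝ := fun u => ⟪u, gradient ξ y⟫ ^ 2 + ξ y ^ 2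
    - 2 * (iteratedFDeriv ℝ 2 ξ y ![u, u]) * ξ y
    - 2 * ⟪Efld s (near y), gradient ξ (near y)⟫ * ξ y with hS
  have hal : ∀ u, min (√(S u)) (δ' / 4) ≤ alphaW ξ Ω Efld near χ δw Cδ s y u := by
    intro u
    rw [alphaW, if_pos hd]
    exact aux_chi χ δ' Cδ hδ' hχid hχc hχmono _ (Real.sqrt_nonneg _)
  have hSlow : ∀ u, ⟪u, gradient ξ y⟫ ^ 2 + X ^ 2 + 2 * Cc * ‖u‖ ^ 2 * X + 2 * c0 * CE * X
      ≤ S u := by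
    intro u
    have h1 := mul_le_mul_of_nonneg_right (hconv y hy u) hXpos.le
    have h2 := mul_le_mul_of_nonneg_right hEn hXpos.le
    simp only [hS]
    rw [hXe]
    linarith
  by_cases hbig : ε / 2 ≤ X
  · refine le_trans ?_ (hP1le.trans le_add_self)
    apply aux_const θ (2 - κ) βe m (by linarith) hmpos v
    intro u
    refine le_trans (le_min ?_ hm1) (hal u)
    refine (hm3.trans hbig).trans (Real.le_sqrt_of_sq_le ?_)
    refine le_trans ?_ (hSlow u)
    have : 0 ≤ ⟪u, gradient ξ y⟫ ^ 2 + 2 * Cc * ‖u‖ ^ 2 * X + 2 * c0 * CE * X := by positivity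
    linarith
  · have hgy := hgr y hy (le_of_not_ge hbig)
    have hmain := aux_main θ (2 - κ) βe m c c0 CE k hθ (by linarith) hβ1 hmpos hcpos hc0 hCE hk
      X hXpos (gradient ξ y) hgy v (alphaW ξ Ω Efld near χ δw Cδ s y) S
      (by
        intro u
        refine le_trans ?_ (hSlow u)
        have hc1 : c ≤ 1 := min_le_left _ _
        have hc2 : c ≤ 2 * Cc := (min_le_right _ _).trans (min_le_left _ _)
        have hc3 : c ≤ 2 * c0 := (min_le_right _ _).trans (min_le_right _ _)
        have e1 : c * X ^ 2 ≤ 1 * X ^ 2 := by gcongr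
        have e2 : c * (‖u‖ ^ 2 * X) ≤ 2 * Cc * (‖u‖ ^ 2 * X) := by gcongr
        have e3 : c * (CE * X) ≤ 2 * c0 * (CE * X) := by gcongr
        linarith)
      (fun u => le_trans (min_le_min_left _ hm1) (hal u))
    have hsq : ξ y ^ 2 = X ^ 2 := by rw [hX, sq_abs]
    rw [hsq]
    refine hmain.trans ?_
    rw [add_comm]
    exact add_le_add (mul_le_mul_left hP2le _) hP1le

end
end
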